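/- arXiv:2305.06285 — 2 statements merged into one kernel-verified Lean document; each statement's English description precedes it below -/
import Mathlib

section
/- Let O be a non-trivial m-ovoid of the elliptic quadric Q^-(2r+1,q), r ≥ 2. Then m ≥ (−3 + √(9 + 4(q^{r+1} + q − 2)))/(2(q−1)). -/
noncomputable section

open scoped BigOperators

namespace PolarOvoids

/-- The kind of the polar space `P'_{r,e}`: the elliptic quadric `Q⁻(2r+1,q)` (`e = 2`),
the symplectic polar space `W(2r-1,q)` (`e = 1`), or the Hermitian polar space `H(2r,q)`
with `q` a square (`e = 3/2`). -/
inductive PolarKind : Type where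
  | elliptic
  | symplectic
  | hermitian

/-- The parameter `e` of the polar space. -/
def PolarKind.e : PolarKind → ℝ
  | .elliptic => 2
  | .symplectic => 1
  | .hermitian => 3 / 2

/-- The dimension `2r + 2e - 2` of the vector space underlying the ambient projective
space `PG(n,q)`, `n = 2r + 2e - 3`. -/
def PolarKind.vdim : PolarKind → ℕ → ℕ
  | .elliptic, r => 2 * r + 2
  | .symplectic, r => 2 * r
  | .hermitian, r => 2 * r + 1

/-- The orthogonal complement (polar image) of a subspace with respect to a
(reflexive) sesquilinear form `B`. -/
def sperp {F V : Type} [Field F] [AddCommGroup V] [Module F V] {σ : F →+* F}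
    (B : V →ₗ[F] V →ₛₗ[σ] F) (W : Submodule F V) : Submodule F V where
  carrier := {v | ∀ w ∈ W, B w v = 0}
  add_mem' := by
    intro a b ha hb w hw
    simp only [map_add, ha w hw, hb w hw, add_zero]
  zero_mem' := by
    intro w hw
    simp
  smul_mem' := by
    intro c v hv w hw
    simp only [map_smulₛₗ, hv w hw, smul_zero]

/-- The set of points of the projective space `PG(n,q)` lying in a projective subspace,
given as the corresponding linear subspace `W`. -/
def pts {F V : Type} [Field F] [AddCommGroup V] [Module F V] (W : Submodule F V) :
    Set (Projectivization F V) := {p | p.rep ∈ W}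

/-- The total weight `μ(S) = ∑_{p ∈ S} μ(p)` of a set `S` of projective points under a
weight function `μ` on the points. -/
def wsum {F V : Type} [Field F] [AddCommGroup V] [Module F V]
    (μ : Projectivization F V → ℕ) (S : Set (Projectivization F V)) : ℝ :=
  ∑ᶠ p ∈ S, (μ p : ℝ)

/-- The weight `μ(S) = |S ∩ O|` of a point set `S` with respect to the point set `O`. -/
def nwt {X : Type} (O S : Set X) : ℝ := ((S ∩ O).ncard : ℝ)

/-- The defining property of each kind of polar space, in terms of the companion
automorphism `σ`, the sesquilinear form `B` inducing the polarity, the point set `sing`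
of the polar space and the predicate `ti` of total isotropy (resp. total singularity):
* symplectic: `B` is a non-degenerate alternating bilinear form;
* Hermitian: `B` is a non-degenerate Hermitian form with respect to the involutory field
  automorphism `σ` (so the field order is a square `q` and `σ : x ↦ x^√q`);
* elliptic: `B` is the bilinear form associated to a non-singular quadratic form `Q`,
  of Witt index `r` (imposed by the rank axioms below). -/
def PolarKind.Spec {F : Type} [Field F] {N : ℕ} :
    (k : PolarKind) → (σ : F →+* F) →
    ((Fin N → F) →ₗ[F] (Fin N → F) →ₛₗ[σ] F) →
    Set (Projectivization F (Fin N → F)) →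
    (Submodule F (Fin N → F) → Prop) → Prop
  | .symplectic, σ, B, sing, ti =>
      σ = RingHom.id F ∧ (∀ v, B v v = 0) ∧ sing = Set.univ ∧
        ∀ W, ti W ↔ ∀ v ∈ W, ∀ w ∈ W, B v w = 0
  | .hermitian, σ, B, sing, ti =>
      σ ≠ RingHom.id F ∧ σ.comp σ = RingHom.id F ∧
        (∀ v w, B w v = σ (B v w)) ∧
        sing = {p | B p.rep p.rep = 0} ∧
        ∀ W, ti W ↔ ∀ v ∈ W, ∀ w ∈ W, B v w = 0
  | .elliptic, σ, B, sing, ti =>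
      σ = RingHom.id F ∧
        ∃ Q : QuadraticForm F (Fin N → F),
          (∀ v w, QuadraticMap.polar (⇑Q) v w = B v w) ∧
          sing = {p | Q p.rep = 0} ∧
          ∀ W, ti W ↔ ∀ v ∈ W, Q v = 0

/-- A finite classical polar space `P'_{r,e}` of rank `r` and kind `k` over the finite
field `F` (of order `q`), consisting of the totally isotropic (resp. totally singular)
subspaces with respect to the defining form.  Its ambient projective space is
`PG(2r + 2e - 3, q)`, whose points are the points of `Projectivization F (Fin (k.vdim r) → F)`
and whose `j`-dimensional projective subspaces correspond to the linear subspaces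
`W : Submodule F (Fin (k.vdim r) → F)` with `Module.finrank F W = j + 1`.
The polarity `⊥` of the ambient projective space is induced by the non-degenerate
reflexive (sesquilinear) form `B`; the rank axioms state that the Witt index is `r`,
i.e. generators have projective dimension `r - 1`. -/
structure PolarSpace (F : Type) [Field F] (r : ℕ) (k : PolarKind) where
  σ : F →+* F
  B : (Fin (k.vdim r) → F) →ₗ[F] (Fin (k.vdim r) → F) →ₛₗ[σ] F
  nondeg : ∀ v, (∀ w, B v w = 0) → v = 0
  sing : Set (Projectivization F (Fin (k.vdim r) → F))
  ti : Submodule F (Fin (k.vdim r) → F) → Prop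
  spec : k.Spec σ B sing ti
  rank_exists : ∃ W, ti W ∧ Module.finrank F ↥W = r
  rank_le : ∀ W, ti W → Module.finrank F ↥W ≤ r

namespace PolarSpace

variable {F : Type} [Field F] {r : ℕ} {k : PolarKind}

/-- The image `π^⊥` of a subspace `π` under the polarity of the ambient projective space. -/
def perp (P : PolarSpace F r k) (W : Submodule F (Fin (k.vdim r) → F)) :
    Submodule F (Fin (k.vdim r) → F) := sperp P.B W

/-- The image `p^⊥` of a point `p` under the polarity of the ambient projective space. -/
def pperp (P : PolarSpace F r k) (p : Projectivization F (Fin (k.vdim r) → F)) :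
    Submodule F (Fin (k.vdim r) → F) := sperp P.B (Submodule.span F {p.rep})

/-- A generator: a maximal totally isotropic (totally singular) subspace, i.e. one of
projective dimension `r - 1`. -/
def IsGenerator (P : PolarSpace F r k) (W : Submodule F (Fin (k.vdim r) → F)) : Prop :=
  P.ti W ∧ Module.finrank F ↥W = r

/-- An `m`-ovoid: a set `O` of points of the polar space such that every generator
contains exactly `m` points of `O`. -/
def IsMOvoid (P : PolarSpace F r k) (m : ℕ)
    (O : Set (Projectivization F (Fin (k.vdim r) → F))) : Prop :=
  O ⊆ P.sing ∧ ∀ W, P.IsGenerator W → (pts W ∩ O).ncard = m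

/-- A non-trivial `m`-ovoid: an `m`-ovoid with `0 < m < θ_{r-1} = (q^r - 1)/(q - 1)`,
the number of points of a generator. -/
def IsNontrivialMOvoid [Fintype F] (P : PolarSpace F r k) (m : ℕ)
    (O : Set (Projectivization F (Fin (k.vdim r) → F))) : Prop :=
  P.IsMOvoid m O ∧ 0 < m ∧ m < ∑ i ∈ Finset.range r, Fintype.card F ^ i

/-- A weighted `m`-ovoid: a function `μ` assigning a natural number to each point of the
ambient projective space, vanishing on points not in the polar space, such that
`μ(p^⊥) + q^{r+e-2}·μ(p) = m·(q^{r+e-2} + 1)` for every point `p` of `PG(n,q)`. -/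
def IsWeightedMOvoid [Fintype F] (P : PolarSpace F r k) (m : ℕ)
    (μ : Projectivization F (Fin (k.vdim r) → F) → ℕ) : Prop :=
  (∀ p, p ∉ P.sing → μ p = 0) ∧
  ∀ p, wsum μ (pts (P.pperp p)) +
      (Fintype.card F : ℝ) ^ ((r : ℝ) + k.e - 2) * (μ p : ℝ)
    = (m : ℝ) * ((Fintype.card F : ℝ) ^ ((r : ℝ) + k.e - 2) + 1)

end PolarSpace

open Classical in
/-- Fibre count for a non-zero linear functional. -/
theorem card_mul_card_fiber {F U : Type*} [Field F] [Fintype F] [AddCommGroup U] [Module F U]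
    [Fintype U] (φ : U →ₗ[F] F) (hφ : φ ≠ 0) (c : F) :
    Fintype.card F * (Finset.univ.filter fun u => φ u = c).card = Fintype.card U := by
  have hsurj : Function.Surjective φ := LinearMap.surjective hφ
  have h : ∑ d : F, (Finset.univ.filter fun u => φ u = d).card = Fintype.card U := by
    rw [← Finset.card_univ (α := U),
      Finset.card_eq_sum_card_fiberwise (f := φ) (t := Finset.univ) (by simp)]
  rw [← h, Finset.sum_congr rfl fun d _ =>
    AddMonoidHom.card_fiber_eq_of_mem_range φ (hsurj d) (hsurj c)]
  simp

section Fourier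

variable {F V : Type*} [Field F] [Fintype F] [AddCommGroup V] [Module F V] [Fintype V]

open Classical in
omit [Fintype F] in
/-- Orthogonality relation for the additive characters `w ↦ ψ (B v w)`. -/
theorem sum_addChar_bilin (B : LinearMap.BilinForm F V) (hB : ∀ v, (∀ w, B v w = 0) → v = 0)
    {ψ : AddChar F ℂ} (hψ : ψ.IsPrimitive) (v : V) :
    ∑ w, ψ (B v w) = if v = 0 then (Fintype.card V : ℂ) else 0 := by
  split_ifs with hv
  · simp [hv]
  · obtain ⟨w, hw⟩ : ∃ w, B v w ≠ 0 := by
      by_contra! h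
      exact hv (hB v h)
    have hne : ψ.compAddMonoidHom (B v).toAddMonoidHom ≠ 1 := by
      intro h
      refine hψ hw ?_
      ext t
      have := DFunLike.congr_fun h (t • w)
      simpa [AddChar.mulShift_apply, mul_comm] using this
    simpa using AddChar.sum_eq_zero_of_ne_one hne

/-- The Fourier transform of a function on `V` that is invariant under non-zero scalars,
expressed through its sums over hyperplanes. -/
def hypTransform (B : LinearMap.BilinForm F V) (g : V → ℝ) (w : V) : ℝ :=
  ((Fintype.card F : ℝ) * (∑ v, open Classical in if B v w = 0 then g v else 0) - ∑ v, g v) /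
    ((Fintype.card F : ℝ) - 1)

theorem card_sub_one_pos : (0 : ℝ) < (Fintype.card F : ℝ) - 1 := by
  have : (1 : ℝ) < Fintype.card F := by exact_mod_cast Fintype.one_lt_card
  linarith

open Classical in
theorem sum_units_addChar {ψ : AddChar F ℂ} (hψ : ψ.IsPrimitive) (b : F) :
    ∑ t : Fˣ, ψ (t * b) = (Fintype.card F : ℂ) * (if b = 0 then 1 else 0) - 1 := by
  have h := AddChar.sum_mulShift b hψ
  have h2 : ∑ t : F, ψ (t * b) = ∑ t : Fˣ, ψ (t * b) + 1 := by
    rw [← Finset.sum_erase_add _ _ (Finset.mem_univ (0 : F))]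
    congr 1
    · symm
      refine Finset.sum_bij (fun t _ => (t : F)) ?_ ?_ ?_ ?_
      · simp
      · intro a _ b _ h
        exact Units.ext h
      · intro t ht
        exact ⟨Units.mk0 t (Finset.ne_of_mem_erase ht), by simp, rfl⟩
      · simp
    · simp
  rw [h2] at h
  rw [eq_sub_iff_add_eq, h]
  split_ifs <;> simp

theorem hypTransform_eq (B : LinearMap.BilinForm F V) {ψ : AddChar F ℂ} (hψ : ψ.IsPrimitive)
    {g : V → ℝ} (hg : ∀ c : F, c ≠ 0 → ∀ v, g (c • v) = g v) (w : V) :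
    (hypTransform B g w : ℂ) = ∑ v, (g v : ℂ) * ψ (B v w) := by
  classical
  have hpos := card_sub_one_pos (F := F)
  have hne : (Fintype.card F : ℂ) - 1 ≠ 0 := by exact_mod_cast hpos.ne'
  have hinv : ∀ t : Fˣ, ∑ v, (g v : ℂ) * ψ (B v w) = ∑ v, (g v : ℂ) * ψ (t * B v w) := by
    intro t
    rw [← Equiv.sum_comp (MulAction.toPerm t : Equiv.Perm V)]
    refine Finset.sum_congr rfl fun v _ => ?_
    simp only [MulAction.toPerm_apply, Units.smul_def, hg _ t.ne_zero]
    simp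
  have hsum : ((Fintype.card F : ℂ) - 1) * ∑ v, (g v : ℂ) * ψ (B v w) =
      (Fintype.card F : ℂ) * (∑ v, if B v w = 0 then (g v : ℂ) else 0) - ∑ v, (g v : ℂ) := by
    have hc : ((Fintype.card F : ℂ) - 1) = ∑ _t : Fˣ, (1 : ℂ) := by
      rw [Finset.sum_const, Finset.card_univ, Fintype.card_units,
        nsmul_eq_mul, mul_one, Nat.cast_sub Fintype.card_pos]
      simp
    rw [hc, Finset.sum_mul, Finset.sum_congr rfl fun t _ => by rw [one_mul, hinv t],
      Finset.sum_comm, Finset.mul_sum, ← Finset.sum_sub_distrib]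
    refine Finset.sum_congr rfl fun v _ => ?_
    rw [← Finset.mul_sum, sum_units_addChar hψ]
    split_ifs <;> simp; ring
  rw [hypTransform]
  push_cast
  rw [div_eq_iff hne, mul_comm _ ((Fintype.card F : ℂ) - 1), hsum]
  congr 2
  refine Finset.sum_congr rfl fun v _ => ?_
  split_ifs <;> simp

/-- Fourier inversion for the square of the transform. -/
theorem sum_hypTransform_sq (B : LinearMap.BilinForm F V) (hB : ∀ v, (∀ w, B v w = 0) → v = 0)
    {ψ : AddChar F ℂ} (hψ : ψ.IsPrimitive)
    {g : V → ℝ} (hg : ∀ c : F, c ≠ 0 → ∀ v, g (c • v) = g v) (v : V) :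
    ∑ w, (hypTransform B g w : ℂ) ^ 2 * ψ (B (-v) w) =
      (Fintype.card V : ℂ) * ∑ a, (g a : ℂ) * g (v - a) := by
  classical
  have h1 : ∀ w, (hypTransform B g w : ℂ) ^ 2 * ψ (B (-v) w) =
      ∑ a, ∑ b, (g a : ℂ) * g b * ψ (B (a + b - v) w) := by
    intro w
    rw [hypTransform_eq B hψ hg, sq, Finset.sum_mul_sum, Finset.sum_mul]
    refine Finset.sum_congr rfl fun a _ => ?_
    rw [Finset.sum_mul]
    refine Finset.sum_congr rfl fun b _ => ?_
    rw [sub_eq_add_neg, map_add, map_add, LinearMap.add_apply, LinearMap.add_apply,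
      AddChar.map_add_eq_mul, AddChar.map_add_eq_mul]
    ring
  rw [Finset.sum_congr rfl fun w _ => h1 w, Finset.sum_comm, Finset.mul_sum]
  refine Finset.sum_congr rfl fun a _ => ?_
  rw [Finset.sum_comm, Finset.sum_eq_single (v - a)]
  · rw [← Finset.mul_sum, sum_addChar_bilin B hB hψ]
    simp; ring
  · intro b _ hb
    rw [← Finset.mul_sum, sum_addChar_bilin B hB hψ, if_neg, mul_zero]
    intro h
    exact hb (by rw [eq_sub_iff_add_eq, ← sub_eq_zero, ← h]; abel)
  · simp

end Fourier

section Quadric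

variable {F V : Type*} [Field F] [AddCommGroup V] [Module F V]

/-- A subspace on which the quadratic form vanishes. -/
def TotSing (Q : QuadraticForm F V) (U : Submodule F V) : Prop := ∀ v ∈ U, Q v = 0

/-- The orthogonal complement with respect to the polar form. -/
def qperp (Q : QuadraticForm F V) (U : Submodule F V) : Submodule F V :=
  LinearMap.BilinForm.orthogonal Q.polarBilin U

variable {Q : QuadraticForm F V} {U : Submodule F V}

theorem mem_qperp {v : V} : v ∈ qperp Q U ↔ ∀ u ∈ U, QuadraticMap.polar Q u v = 0 := by
  simp [qperp, LinearMap.BilinForm.mem_orthogonal_iff]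

theorem map_add_polar (Q : QuadraticForm F V) (v w : V) :
    Q (v + w) = Q v + Q w + QuadraticMap.polar Q v w := by
  rw [QuadraticMap.polar]; ring

theorem TotSing.le_qperp (hU : TotSing Q U) : U ≤ qperp Q U := by
  intro v hv
  rw [mem_qperp]
  intro u hu
  rw [QuadraticMap.polar, hU _ (U.add_mem hu hv), hU _ hu, hU _ hv]
  ring

theorem TotSing.adjoin (hU : TotSing Q U) {w : V} (hw : w ∈ qperp Q U) (hQ : Q w = 0) :
    TotSing Q (U ⊔ Submodule.span F {w}) := by
  intro v hv
  obtain ⟨u, hu, y, hy, rfl⟩ := Submodule.mem_sup.1 hv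
  obtain ⟨c, rfl⟩ := Submodule.mem_span_singleton.1 hy
  rw [map_add_polar, hU u hu, QuadraticMap.map_smul, hQ, QuadraticMap.polar_smul_right,
    mem_qperp.1 hw u hu]
  simp

theorem mem_qperp_adjoin {v w : V} :
    v ∈ qperp Q (U ⊔ Submodule.span F {w}) ↔ v ∈ qperp Q U ∧ QuadraticMap.polar Q w v = 0 := by
  constructor
  · intro h
    rw [mem_qperp] at h
    exact ⟨mem_qperp.2 fun u hu => h u (Submodule.mem_sup_left hu),
      h w (Submodule.mem_sup_right (Submodule.mem_span_singleton_self w))⟩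
  · rintro ⟨h1, h2⟩
    rw [mem_qperp]
    intro x hx
    obtain ⟨u, hu, y, hy, rfl⟩ := Submodule.mem_sup.1 hx
    obtain ⟨c, rfl⟩ := Submodule.mem_span_singleton.1 hy
    rw [QuadraticMap.polar_add_left, QuadraticMap.polar_smul_left, mem_qperp.1 h1 u hu, h2]
    simp

theorem mem_adjoin_exchange {v w : V} (hv : v ∈ U ⊔ Submodule.span F {w}) (hvU : v ∉ U) :
    w ∈ U ⊔ Submodule.span F {v} := by
  obtain ⟨u, hu, y, hy, rfl⟩ := Submodule.mem_sup.1 hv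
  obtain ⟨c, rfl⟩ := Submodule.mem_span_singleton.1 hy
  have hc : c ≠ 0 := by
    rintro rfl
    exact hvU (by simpa using hu)
  have h : w = -(c⁻¹ • u) + c⁻¹ • (u + c • w) := by
    rw [smul_add, smul_smul, inv_mul_cancel₀ hc, one_smul]; abel
  have h' := Submodule.add_mem (U ⊔ Submodule.span F {u + c • w})
    (Submodule.mem_sup_left (U.neg_mem (U.smul_mem c⁻¹ hu)))
    (Submodule.mem_sup_right (Submodule.smul_mem _ c⁻¹ (Submodule.mem_span_singleton_self _)))
  rwa [← h] at h'

theorem finrank_adjoin [FiniteDimensional F V] {w : V} (hw : w ∉ U) :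
    Module.finrank F ↥(U ⊔ Submodule.span F {w}) = Module.finrank F U + 1 := by
  have hw0 : w ≠ 0 := by
    rintro rfl
    exact hw U.zero_mem
  have h1 := Submodule.finrank_add_le_finrank_add_finrank U (Submodule.span F {w})
  rw [finrank_span_singleton hw0] at h1
  have h2 : U < U ⊔ Submodule.span F {w} :=
    lt_of_le_of_ne le_sup_left fun h => hw (h ▸
      Submodule.mem_sup_right (Submodule.mem_span_singleton_self w))
  have h3 := Submodule.finrank_lt_finrank_of_lt h2
  omega

theorem TotSing.mem_of_maximal [FiniteDimensional F V] {r : ℕ}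
    (hle : ∀ W, TotSing Q W → Module.finrank F W ≤ r)
    (hU : TotSing Q U) (hdim : Module.finrank F U = r)
    {w : V} (hw : w ∈ qperp Q U) (hQ : Q w = 0) : w ∈ U := by
  by_contra h
  have := hle _ (hU.adjoin hw hQ)
  rw [finrank_adjoin h] at this
  omega

variable [Fintype F] [Fintype V]

open Classical

theorem card_submodule (U : Submodule F V) :
    (Finset.univ.filter (· ∈ U)).card = Fintype.card F ^ Module.finrank F U := by
  rw [← Module.card_eq_pow_finrank (K := F) (V := U), Fintype.card_subtype]

theorem card_qperp (hnd : ∀ v, (∀ w, QuadraticMap.polar Q v w = 0) → v = 0) :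
    Fintype.card F ^ Module.finrank F U * (Finset.univ.filter (· ∈ qperp Q U)).card =
      Fintype.card F ^ Module.finrank F V := by
  have hker : LinearMap.ker Q.polarBilin = ⊥ := by
    rw [LinearMap.ker_eq_bot']
    intro v hv
    exact hnd v fun w => by simpa using LinearMap.congr_fun hv w
  have h := LinearMap.BilinForm.finrank_add_finrank_orthogonal' (B := Q.polarBilin) U
  rw [hker, inf_bot_eq, finrank_bot, add_zero] at h
  rw [card_submodule, ← pow_add, ← h, qperp]

/-- Exactly one vector in `q` is singular outside the perp of a totally singular subspace. -/
theorem card_singular_not_mem_qperp (hU : TotSing Q U) :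
    Fintype.card F * (Finset.univ.filter fun v => Q v = 0 ∧ v ∉ qperp Q U).card =
      (Finset.univ.filter fun v => v ∉ qperp Q U).card := by
  have hshift : ∀ u : U, (Finset.univ.filter fun v => Q v = 0 ∧ v ∉ qperp Q U).card =
      ∑ v, if Q (v + u) = 0 ∧ v ∉ qperp Q U then 1 else 0 := by
    intro u
    rw [Finset.card_filter, ← Equiv.sum_comp (Equiv.addRight (u : V))]
    refine Finset.sum_congr rfl fun v _ => ?_
    simp only [Equiv.coe_addRight, Submodule.add_mem_iff_left _ (hU.le_qperp u.2)]
  have hcard : Fintype.card U * (Finset.univ.filter fun v => Q v = 0 ∧ v ∉ qperp Q U).card =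
      ∑ v, ∑ u : U, if Q (v + u) = 0 ∧ v ∉ qperp Q U then 1 else 0 := by
    rw [Finset.sum_comm, ← Finset.sum_congr rfl fun u _ => hshift u]
    simp
  have hfib : ∀ v, Fintype.card F * (∑ u : U, if Q (v + u) = 0 ∧ v ∉ qperp Q U then 1 else 0) =
      Fintype.card U * if v ∉ qperp Q U then 1 else 0 := by
    intro v
    by_cases hv : v ∈ qperp Q U
    · simp [hv]
    · have hφ : (Q.polarBilin v).domRestrict U ≠ 0 := by
        intro h
        refine hv (mem_qperp.2 fun u hu => ?_)
        rw [QuadraticMap.polar_comm]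
        simpa using LinearMap.congr_fun h ⟨u, hu⟩
      rw [if_pos hv, mul_one, ← card_mul_card_fiber _ hφ (-Q v), Finset.card_filter]
      congr 1
      refine Finset.sum_congr rfl fun u _ => ?_
      simp only [hv, not_false_eq_true, and_true, map_add_polar, hU u u.2, add_zero,
        LinearMap.domRestrict_apply, QuadraticMap.polarBilin_apply_apply]
      congr 1
      rw [eq_neg_iff_add_eq_zero, add_comm]
  refine Nat.eq_of_mul_eq_mul_left (Fintype.card_pos (α := U)) ?_
  rw [mul_left_comm, hcard, Finset.mul_sum, Finset.sum_congr rfl fun v _ => hfib v,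
    ← Finset.mul_sum, Finset.card_filter]

/-- The number of singular vectors in the perp of a totally singular subspace. -/
theorem card_singular_qperp {r : ℕ} (hV : Module.finrank F V = 2 * r + 2)
    (hnd : ∀ v, (∀ w, QuadraticMap.polar Q v w = 0) → v = 0)
    (hex : ∃ W, TotSing Q W ∧ Module.finrank F W = r)
    (hle : ∀ W, TotSing Q W → Module.finrank F W ≤ r)
    (hU : TotSing Q U) {s : ℕ} (hs : Module.finrank F U + s = r) :
    ((Finset.univ.filter fun v => Q v = 0 ∧ v ∈ qperp Q U).card : ℝ) =
      (Fintype.card F : ℝ) ^ Module.finrank F U * ((Fintype.card F : ℝ) ^ s -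
        (Fintype.card F : ℝ) ^ (s + 1) + (Fintype.card F : ℝ) ^ (2 * s + 1)) := by
  have hq : (0 : ℝ) < Fintype.card F := by exact_mod_cast Fintype.card_pos
  have key : ∀ W, TotSing Q W →
      (Fintype.card F : ℝ) ^ Module.finrank F W * ((Fintype.card F : ℝ) *
        ((Finset.univ.filter fun v => Q v = 0).card -
          (Finset.univ.filter fun v => Q v = 0 ∧ v ∈ qperp Q W).card)) =
      (Fintype.card F : ℝ) ^ Module.finrank F W * (Fintype.card F : ℝ) ^ (2 * r + 2) -
        (Fintype.card F : ℝ) ^ (2 * r + 2) := by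
    intro W hW
    have h1 := card_singular_not_mem_qperp hW
    have h2 := Finset.card_filter_add_card_filter_not (s := (Finset.univ : Finset V))
      (· ∈ qperp Q W)
    have h3 := Finset.card_filter_add_card_filter_not
      (s := (Finset.univ.filter fun v : V => Q v = 0)) (· ∈ qperp Q W)
    have h4 := card_qperp (U := W) hnd
    rw [Finset.filter_filter, Finset.filter_filter] at h3
    rw [Finset.card_univ, Module.card_eq_pow_finrank (K := F), hV] at h2
    rw [hV] at h4
    rify at h1 h2 h3 h4
    rw [← h3, add_sub_cancel_left, h1, ← h4]
    rw [← h4] at h2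
    linear_combination (Fintype.card F : ℝ) ^ Module.finrank F W * h2
  obtain ⟨G, hG, hGr⟩ := hex
  have hGz : ((Finset.univ.filter fun v => Q v = 0 ∧ v ∈ qperp Q G).card : ℝ) =
      (Fintype.card F : ℝ) ^ r := by
    rw [← hGr]
    norm_cast
    rw [← card_submodule]
    congr 1
    ext v
    simp only [Finset.mem_filter, Finset.mem_univ, true_and]
    exact ⟨fun h => hG.mem_of_maximal hle hGr h.2 h.1, fun h => ⟨hG v h, hG.le_qperp h⟩⟩
  have hk1 := key G hG
  have hk2 := key U hU
  rw [hGz, hGr] at hk1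
  set q : ℝ := (Fintype.card F : ℝ)
  set N : ℝ := ((Finset.univ.filter fun v => Q v = 0).card : ℝ)
  have hN : q * (N - q ^ r) = q ^ (2 * r + 2) - q ^ (r + 2) := by
    have : q ^ r ≠ 0 := by positivity
    apply mul_left_cancel₀ this
    rw [hk1]; ring
  have hne : q ^ Module.finrank F U * q ≠ 0 := by positivity
  apply mul_left_cancel₀ hne
  subst hs
  generalize Module.finrank F U = k at *
  linear_combination -hk2 + q ^ k * hN

open Finset in
/-- A function on the singular vectors summing to zero over every generator has, for every
totally singular subspace `U` of corank `s` in a generator, its sum over the perp of `U`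
determined by its sum over `U`. -/
theorem sum_qperp_eq {r : ℕ} (hV : Module.finrank F V = 2 * r + 2)
    (hnd : ∀ v, (∀ w, QuadraticMap.polar Q v w = 0) → v = 0)
    (hex : ∃ W, TotSing Q W ∧ Module.finrank F W = r)
    (hle : ∀ W, TotSing Q W → Module.finrank F W ≤ r)
    {g : V → ℝ} (hg : ∀ v, Q v ≠ 0 → g v = 0)
    (hgen : ∀ W, TotSing Q W → Module.finrank F W = r → ∑ v, (if v ∈ W then g v else 0) = 0)
    (s : ℕ) : ∀ U, TotSing Q U → Module.finrank F U + s = r →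
      ∑ v, (if v ∈ qperp Q U then g v else 0) =
        -(Fintype.card F : ℝ) ^ (s + 1) * ∑ v, (if v ∈ U then g v else 0) := by
  induction s with
  | zero =>
    intro U hU hs
    rw [add_zero] at hs
    rw [hgen U hU hs, mul_zero]
    refine Eq.trans ?_ (hgen U hU hs)
    refine sum_congr rfl fun v _ => ?_
    by_cases hQ : Q v = 0
    · have : v ∈ qperp Q U ↔ v ∈ U :=
        ⟨fun h => hU.mem_of_maximal hle hs h hQ, fun h => hU.le_qperp h⟩
      simp only [this]
    · simp only [hg v hQ, ite_self]
  | succ s ih =>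
    intro U hU hs
    set R : Finset V := univ.filter fun w => Q w = 0 ∧ w ∈ qperp Q U ∧ w ∉ U with hR
    have hmemR : ∀ w, w ∈ R ↔ Q w = 0 ∧ w ∈ qperp Q U ∧ w ∉ U := by simp [hR]
    have hdim : ∀ w ∈ R, Module.finrank F ↥(U ⊔ Submodule.span F {w}) + s = r := by
      intro w hw
      rw [finrank_adjoin ((hmemR w).1 hw).2.2]
      omega
    have hts : ∀ w ∈ R, TotSing Q (U ⊔ Submodule.span F {w}) := fun w hw =>
      hU.adjoin ((hmemR w).1 hw).2.1 ((hmemR w).1 hw).1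
    have hRsum : ∀ h : V → ℝ, ∑ v ∈ R, h v =
        ∑ v, if Q v = 0 ∧ v ∈ qperp Q U ∧ v ∉ U then h v else 0 := fun h => by
      rw [hR, sum_filter]
    have hcardR : (#R : ℝ) + (Fintype.card F : ℝ) ^ Module.finrank F U =
        (univ.filter fun v => Q v = 0 ∧ v ∈ qperp Q U).card := by
      have h := card_filter_add_card_filter_not
        (s := univ.filter fun v => Q v = 0 ∧ v ∈ qperp Q U) (· ∈ U)
      rw [filter_filter, filter_filter] at h
      rw [← h, add_comm]
      push_cast
      congr 1
      · norm_cast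
        rw [← card_submodule]
        congr 1
        ext v
        simp only [mem_filter, mem_univ, true_and]
        exact ⟨fun h => ⟨⟨hU v h, hU.le_qperp h⟩, h⟩, fun h => h.2⟩
      · simp only [hR, and_assoc]
    have hcardperp : ∀ v ∈ R, ((R.filter fun w => QuadraticMap.polar Q w v = 0).card : ℝ) +
        (Fintype.card F : ℝ) ^ Module.finrank F U =
        (univ.filter fun w => Q w = 0 ∧ w ∈ qperp Q (U ⊔ Submodule.span F {v})).card := by
      intro v hv
      have h := card_filter_add_card_filter_not
        (s := univ.filter fun w => Q w = 0 ∧ w ∈ qperp Q (U ⊔ Submodule.span F {v})) (· ∈ U)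
      rw [filter_filter, filter_filter] at h
      rw [← h, add_comm]
      push_cast
      congr 1
      · norm_cast
        rw [← card_submodule]
        congr 1
        ext w
        simp only [mem_filter, mem_univ, true_and]
        refine ⟨fun h => ⟨⟨hU w h, (hts v hv).le_qperp (Submodule.mem_sup_left h)⟩, h⟩,
          fun h => h.2⟩
      · congr 2
        ext w
        simp only [mem_filter, hmemR, mem_univ, true_and, mem_qperp_adjoin,
          QuadraticMap.polar_comm Q w v]
        tauto
    have hcardadj : ∀ v ∈ R, ((R.filter fun w => v ∈ U ⊔ Submodule.span F {w}).card : ℝ) +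
        (Fintype.card F : ℝ) ^ Module.finrank F U =
        (Fintype.card F : ℝ) ^ (Module.finrank F U + 1) := by
      intro v hv
      obtain ⟨hv1, hv2, hv3⟩ := (hmemR v).1 hv
      rw [← finrank_adjoin hv3]
      norm_cast
      rw [← card_submodule, ← card_submodule]
      have h := card_filter_add_card_filter_not
        (s := univ.filter fun w => w ∈ U ⊔ Submodule.span F {v}) (· ∈ U)
      rw [filter_filter, filter_filter] at h
      rw [← h, add_comm]
      congr 1
      · congr 1
        ext w
        simp only [mem_filter, mem_univ, true_and]
        exact ⟨fun h => ⟨Submodule.mem_sup_left h, h⟩, fun h => h.2⟩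
      · congr 1
        ext w
        simp only [mem_filter, mem_univ, true_and, hmemR]
        constructor
        · rintro ⟨⟨_, _, h3⟩, h4⟩
          exact ⟨mem_adjoin_exchange h4 hv3, h3⟩
        · rintro ⟨h1, h2⟩
          refine ⟨⟨hts v hv w h1, ?_, h2⟩, mem_adjoin_exchange h1 h2⟩
          exact (mem_qperp_adjoin.1 ((hts v hv).le_qperp h1)).1
    have hsplit : ∑ v, (if v ∈ qperp Q U then g v else 0) =
        ∑ v, (if v ∈ U then g v else 0) + ∑ v ∈ R, g v := by
      rw [hR, sum_filter, ← sum_add_distrib]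
      refine sum_congr rfl fun v _ => ?_
      by_cases h1 : v ∈ U
      · simp [h1, hU.le_qperp h1]
      · by_cases h2 : Q v = 0 <;> simp [h1, h2, hg]
    have hA : ∑ w ∈ R, ∑ v, (if v ∈ qperp Q (U ⊔ Submodule.span F {w}) then g v else 0) =
        #R * ∑ v, (if v ∈ U then g v else 0) +
        ∑ v ∈ R, g v * (R.filter fun w => QuadraticMap.polar Q w v = 0).card := by
      rw [sum_comm, mul_sum,
        hRsum fun v => g v * (R.filter fun w => QuadraticMap.polar Q w v = 0).card,
        ← sum_add_distrib]
      refine sum_congr rfl fun v _ => ?_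
      by_cases h1 : v ∈ U
      · rw [sum_congr rfl (g := fun _ => g v)]
        · simp [h1]
        · intro w hw
          rw [if_pos]
          rw [mem_qperp_adjoin]
          refine ⟨hU.le_qperp h1, ?_⟩
          rw [QuadraticMap.polar_comm]
          exact mem_qperp.1 ((hmemR w).1 hw).2.1 v h1
      · by_cases h2 : Q v = 0
        · by_cases h3 : v ∈ qperp Q U
          · simp only [mem_qperp_adjoin, h1, h2, h3, true_and, if_true, if_false,
              not_false_eq_true]
            rw [← sum_filter, sum_const, nsmul_eq_mul]
            ring
          · simp [mem_qperp_adjoin, h1, h3]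
        · simp [hg v h2]
    have ha : ∑ w ∈ R, ∑ v, (if v ∈ U ⊔ Submodule.span F {w} then g v else 0) =
        #R * ∑ v, (if v ∈ U then g v else 0) +
        ∑ v ∈ R, g v * (R.filter fun w => v ∈ U ⊔ Submodule.span F {w}).card := by
      rw [sum_comm, mul_sum,
        hRsum fun v => g v * (R.filter fun w => v ∈ U ⊔ Submodule.span F {w}).card,
        ← sum_add_distrib]
      refine sum_congr rfl fun v _ => ?_
      by_cases h1 : v ∈ U
      · rw [sum_congr rfl (g := fun _ => g v)]
        · simp [h1]
        · intro w hw
          rw [if_pos (Submodule.mem_sup_left h1)]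
      · by_cases h2 : Q v = 0
        · by_cases h3 : v ∈ qperp Q U
          · simp only [h1, h2, h3, true_and, if_true, if_false, mul_zero, zero_add,
              not_false_eq_true]
            rw [← sum_filter, sum_const, nsmul_eq_mul]
            ring
          · rw [sum_eq_zero]
            · simp [h1, h3]
            · intro w hw
              rw [if_neg]
              intro h
              exact h3 (mem_qperp_adjoin.1 ((hts w hw).le_qperp h)).1
        · simp [hg v h2]
    have hIH := sum_congr rfl fun w hw => ih _ (hts w hw) (hdim w hw)
    rw [← mul_sum, hA, ha] at hIH
    have hsum1 : ∑ v ∈ R, g v * ((R.filter fun w => QuadraticMap.polar Q w v = 0).card : ℝ) =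
        (∑ v ∈ R, g v) * ((Fintype.card F : ℝ) ^ (Module.finrank F U + 1) *
          ((Fintype.card F : ℝ) ^ s - (Fintype.card F : ℝ) ^ (s + 1) +
            (Fintype.card F : ℝ) ^ (2 * s + 1)) - (Fintype.card F : ℝ) ^ Module.finrank F U) := by
      rw [sum_mul]
      refine sum_congr rfl fun v hv => ?_
      have h := card_singular_qperp hV hnd hex hle (hts v hv) (hdim v hv)
      rw [← hcardperp v hv, finrank_adjoin ((hmemR v).1 hv).2.2] at h
      rw [← h, add_sub_cancel_right]
    have hsum2 : ∑ v ∈ R, g v * ((R.filter fun w => v ∈ U ⊔ Submodule.span F {w}).card : ℝ) =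
        (∑ v ∈ R, g v) * ((Fintype.card F : ℝ) ^ (Module.finrank F U + 1) -
          (Fintype.card F : ℝ) ^ Module.finrank F U) := by
      rw [sum_mul]
      refine sum_congr rfl fun v hv => ?_
      rw [← hcardadj v hv, add_sub_cancel_right]
    have hRc := card_singular_qperp hV hnd hex hle hU hs
    rw [← hcardR] at hRc
    rw [hsum1, hsum2] at hIH
    rw [hsplit]
    have hq : (1 : ℝ) < Fintype.card F := by exact_mod_cast Fintype.one_lt_card
    generalize (Fintype.card F : ℝ) = q at *
    generalize ∑ v ∈ R, g v = b at *
    generalize (∑ v, if v ∈ U then g v else 0) = a at *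
    have hp : 0 < q ^ Module.finrank F U := by positivity
    have ht : 1 < q ^ (s + 1) := one_lt_pow₀ hq (by omega)
    have hne : q ^ Module.finrank F U * (q ^ (s + 1) - 1) * (q ^ (s + 1) + 1) ≠ 0 := by
      have : 0 < q ^ (s + 1) - 1 := by linarith
      positivity
    apply mul_left_cancel₀ hne
    linear_combination hIH - (1 + q ^ (s + 1)) * a * hRc

end Quadric

section Bound

variable {F V : Type*} [Field F] [Fintype F] [AddCommGroup V] [Module F V] [Fintype V]
  {Q : QuadraticForm F V}

open Classical

theorem sum_span_singleton {g : V → ℝ} (hg : ∀ c : F, c ≠ 0 → ∀ v, g (c • v) = g v)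
    {w : V} (hw : w ≠ 0) :
    ∑ v, (if v ∈ Submodule.span F {w} then g v else 0) =
      g 0 + ((Fintype.card F : ℝ) - 1) * g w := by
  have himage : (Finset.univ.filter (· ∈ Submodule.span F {w})) =
      Finset.univ.image fun t : F => t • w := by
    ext v
    simp [Submodule.mem_span_singleton]
  rw [← Finset.sum_filter, himage,
    Finset.sum_image fun a _ b _ h => smul_left_injective F hw h,
    ← Finset.add_sum_erase _ _ (Finset.mem_univ (0 : F)), zero_smul,
    Finset.sum_congr rfl fun t ht => hg t (Finset.ne_of_mem_erase ht) w,
    Finset.sum_const, Finset.card_erase_of_mem (Finset.mem_univ _), Finset.card_univ,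
    nsmul_eq_mul, Nat.cast_sub Fintype.card_pos, Nat.cast_one]

theorem hypTransform_singular {r : ℕ} (hV : Module.finrank F V = 2 * r + 2)
    (hnd : ∀ v, (∀ w, QuadraticMap.polar Q v w = 0) → v = 0)
    (hex : ∃ W, TotSing Q W ∧ Module.finrank F W = r)
    (hle : ∀ W, TotSing Q W → Module.finrank F W ≤ r)
    {g : V → ℝ} (hsmul : ∀ c : F, c ≠ 0 → ∀ v, g (c • v) = g v)
    (hg : ∀ v, Q v ≠ 0 → g v = 0)
    (hgen : ∀ W, TotSing Q W → Module.finrank F W = r → ∑ v, (if v ∈ W then g v else 0) = 0)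
    {w : V} (hw : Q w = 0) :
    hypTransform Q.polarBilin g w = -(Fintype.card F : ℝ) ^ (r + 1) * g w := by
  have hq := card_sub_one_pos (F := F)
  have hbot : ∑ v, g v = -(Fintype.card F : ℝ) ^ (r + 1) * g 0 := by
    have h := sum_qperp_eq hV hnd hex hle hg hgen r ⊥
      (fun v hv => by rw [(Submodule.mem_bot F).1 hv, QuadraticMap.map_zero]) (by simp)
    simpa [mem_qperp] using h
  rw [hypTransform, div_eq_iff hq.ne']
  by_cases hw0 : w = 0
  · subst hw0
    simp only [map_zero, if_true]
    rw [hbot]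
    ring
  · have hts : TotSing Q (Submodule.span F {w}) := by
      intro v hv
      obtain ⟨c, rfl⟩ := Submodule.mem_span_singleton.1 hv
      rw [QuadraticMap.map_smul, hw, smul_zero]
    have hr := hle _ hts
    rw [finrank_span_singleton hw0] at hr
    obtain ⟨s, rfl⟩ := Nat.exists_eq_add_of_le hr
    have h := sum_qperp_eq hV hnd hex hle hg hgen s _ hts (by rw [finrank_span_singleton hw0])
    rw [sum_span_singleton hsmul hw0] at h
    have hmem : ∀ v, v ∈ qperp Q (Submodule.span F {w}) ↔ Q.polarBilin v w = 0 := by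
      intro v
      have := mem_qperp_adjoin (Q := Q) (U := ⊥) (v := v) (w := w)
      rw [bot_sup_eq] at this
      rw [this, QuadraticMap.polarBilin_apply_apply, QuadraticMap.polar_comm]
      simp [mem_qperp]
    simp only [hmem] at h
    rw [h, hbot]
    ring

theorem hypTransform_eq_of_orthogonal_generators {r : ℕ} (hV : Module.finrank F V = 2 * r + 2)
    (hnd : ∀ v, (∀ w, QuadraticMap.polar Q v w = 0) → v = 0)
    (hex : ∃ W, TotSing Q W ∧ Module.finrank F W = r)
    (hle : ∀ W, TotSing Q W → Module.finrank F W ≤ r)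
    {g : V → ℝ} (hsmul : ∀ c : F, c ≠ 0 → ∀ v, g (c • v) = g v)
    (hg : ∀ v, Q v ≠ 0 → g v = 0)
    (hgen : ∀ W, TotSing Q W → Module.finrank F W = r → ∑ v, (if v ∈ W then g v else 0) = 0)
    (w : V) :
    hypTransform Q.polarBilin g w = -(Fintype.card F : ℝ) ^ (r + 1) * g w := by
  have hparseval : ∑ w, hypTransform Q.polarBilin g w ^ 2 =
      (Fintype.card F : ℝ) ^ (2 * r + 2) * ∑ a, g a ^ 2 := by
    have h := sum_hypTransform_sq Q.polarBilin hnd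
      (AddChar.FiniteField.primitiveChar_to_Complex_isPrimitive F) hsmul 0
    have hneg : ∀ a, g (-a) = g a := fun a => by
      rw [← neg_one_smul F a]
      exact hsmul _ (neg_ne_zero.2 one_ne_zero) a
    rw [Module.card_eq_pow_finrank (K := F), hV] at h
    simp only [neg_zero, map_zero, LinearMap.zero_apply, AddChar.map_zero_eq_one, mul_one,
      zero_sub, hneg, ← sq] at h
    exact_mod_cast h
  have hsq : ∀ w, hypTransform Q.polarBilin g w ^ 2 -
      (Fintype.card F : ℝ) ^ (2 * r + 2) * g w ^ 2 =
      (hypTransform Q.polarBilin g w + (Fintype.card F : ℝ) ^ (r + 1) * g w) ^ 2 := by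
    intro w
    by_cases hw : Q w = 0
    · rw [hypTransform_singular hV hnd hex hle hsmul hg hgen hw]
      ring
    · rw [hg w hw]
      ring
  have hzero : ∑ w, (hypTransform Q.polarBilin g w +
      (Fintype.card F : ℝ) ^ (r + 1) * g w) ^ 2 = 0 := by
    rw [← Finset.sum_congr rfl fun w _ => hsq w, Finset.sum_sub_distrib, ← Finset.mul_sum,
      hparseval, sub_self]
  have h := (Finset.sum_eq_zero_iff_of_nonneg fun w _ => sq_nonneg _).1 hzero w
    (Finset.mem_univ w)
  have h' := pow_eq_zero_iff (two_ne_zero) |>.1 h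
  linarith

theorem sum_mul_sub_eq {r : ℕ} (hV : Module.finrank F V = 2 * r + 2)
    (hnd : ∀ v, (∀ w, QuadraticMap.polar Q v w = 0) → v = 0)
    {g : V → ℝ} (hsmul : ∀ c : F, c ≠ 0 → ∀ v, g (c • v) = g v)
    (hH : ∀ w, hypTransform Q.polarBilin g w = -(Fintype.card F : ℝ) ^ (r + 1) * g w) (v : V) :
    ∑ a, g a * g (v - a) = hypTransform Q.polarBilin (fun w => g w ^ 2) (-v) := by
  have hψ := AddChar.FiniteField.primitiveChar_to_Complex_isPrimitive F
  have h := sum_hypTransform_sq Q.polarBilin hnd hψ hsmul v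
  have h2 := hypTransform_eq Q.polarBilin hψ (g := fun w => g w ^ 2)
    (fun c hc v => by simp only [hsmul c hc v]) (-v)
  have hq : (Fintype.card F : ℂ) ^ (2 * r + 2) ≠ 0 := by
    have : (Fintype.card F : ℂ) ≠ 0 := by exact_mod_cast Fintype.card_ne_zero
    exact pow_ne_zero _ this
  rw [Module.card_eq_pow_finrank (K := F), hV] at h
  push_cast at h
  rw [← Complex.ofReal_inj, h2]
  push_cast
  apply mul_left_cancel₀ hq
  rw [← h, Finset.mul_sum]
  refine Finset.sum_congr rfl fun w _ => ?_
  rw [hH]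
  simp only [QuadraticMap.polarBilin_apply_apply]
  rw [QuadraticMap.polar_comm Q (-v) w]
  push_cast
  ring

theorem hypTransform_add_single (B : LinearMap.BilinForm F V) (g : V → ℝ) (c : ℝ) (w : V) :
    hypTransform B (fun v => g v + if v = 0 then c else 0) w = hypTransform B g w + c := by
  have hq := card_sub_one_pos (F := F)
  have h : ∀ v, (if B v w = 0 then g v + (if v = 0 then c else 0) else 0) =
      (if B v w = 0 then g v else 0) + if v = 0 then c else 0 := by
    intro v
    by_cases hv : v = 0
    · simp [hv]
    · simp [hv]
  rw [hypTransform, hypTransform, Finset.sum_congr rfl fun v _ => h v, Finset.sum_add_distrib,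
    Finset.sum_add_distrib, Finset.sum_ite_eq' Finset.univ (0 : V) fun _ => c,
    if_pos (Finset.mem_univ _)]
  field_simp
  ring

theorem card_decompositions {S : Set V} (hS : ∀ c : F, c ≠ 0 → ∀ v, c • v ∈ S ↔ v ∈ S)
    (h0 : (0 : V) ∉ S) {v : V} (hv : v ∈ S) :
    (Fintype.card F : ℝ) - 2 ≤ (Finset.univ.filter fun a => a ∈ S ∧ v - a ∈ S).card := by
  have hv0 : v ≠ 0 := fun h => h0 (h ▸ hv)
  have hsub : (((Finset.univ : Finset F).erase 0).erase 1).image (fun t : F => t • v) ⊆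
      Finset.univ.filter fun a => a ∈ S ∧ v - a ∈ S := by
    intro a ha
    obtain ⟨t, ht, rfl⟩ := Finset.mem_image.1 ha
    simp only [Finset.mem_erase, Finset.mem_univ, and_true] at ht
    simp only [Finset.mem_filter, Finset.mem_univ, true_and]
    refine ⟨(hS t ht.2 v).2 hv, ?_⟩
    have : v - t • v = (1 - t) • v := by rw [sub_smul, one_smul]
    rw [this]
    exact (hS _ (sub_ne_zero.2 (Ne.symm ht.1)) v).2 hv
  have hcard := Finset.card_le_card hsub
  rw [Finset.card_image_of_injective _ (smul_left_injective F hv0),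
    Finset.card_erase_of_mem (by simp), Finset.card_erase_of_mem (by simp),
    Finset.card_univ] at hcard
  have h : Fintype.card F ≤ (Finset.univ.filter fun a => a ∈ S ∧ v - a ∈ S).card + 2 := by
    omega
  have h' : (Fintype.card F : ℝ) ≤
      (Finset.univ.filter fun a => a ∈ S ∧ v - a ∈ S).card + 2 := by exact_mod_cast h
  linarith

/-- The quadratic inequality satisfied by the number `x` of non-zero vectors of the cone `S`
over an ovoid in a generator. -/
theorem cone_bound {r : ℕ} (hV : Module.finrank F V = 2 * r + 2)
    (hnd : ∀ v, (∀ w, QuadraticMap.polar Q v w = 0) → v = 0)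
    (hex : ∃ W, TotSing Q W ∧ Module.finrank F W = r)
    (hle : ∀ W, TotSing Q W → Module.finrank F W ≤ r)
    {S : Set V} (hS : ∀ c : F, c ≠ 0 → ∀ v, c • v ∈ S ↔ v ∈ S)
    (h0 : (0 : V) ∉ S) (hsing : ∀ v ∈ S, Q v = 0) {x : ℝ}
    (hgen : ∀ W, TotSing Q W → Module.finrank F W = r →
      ((Finset.univ.filter fun v => v ∈ W ∧ v ∈ S).card : ℝ) = x)
    {v : V} (hv : v ∈ S) :
    (Fintype.card F : ℝ) ^ (r + 1) + (Fintype.card F : ℝ) - 2 ≤ x ^ 2 + 3 * x := by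
  set g : V → ℝ := fun v => (if v ∈ S then 1 else 0) - if v = 0 then x else 0 with hgdef
  have hsmul : ∀ c : F, c ≠ 0 → ∀ v, g (c • v) = g v := by
    intro c hc v
    simp only [hgdef, hS c hc v, smul_eq_zero, hc, false_or]
  have hg : ∀ v, Q v ≠ 0 → g v = 0 := by
    intro v hQ
    have h1 : v ∉ S := fun h => hQ (hsing v h)
    have h2 : v ≠ 0 := by
      rintro rfl
      exact hQ (QuadraticMap.map_zero Q)
    simp [hgdef, h1, h2]
  have hgen' : ∀ W, TotSing Q W → Module.finrank F W = r →
      ∑ v, (if v ∈ W then g v else 0) = 0 := by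
    intro W hW hr
    rw [← Finset.sum_filter, hgdef, Finset.sum_sub_distrib, Finset.sum_ite_eq',
      if_pos (by simp), ← Finset.sum_filter, Finset.filter_filter, ← hgen W hW hr]
    simp
  have hH := hypTransform_eq_of_orthogonal_generators hV hnd hex hle hsmul hg hgen'
  have hconv := sum_mul_sub_eq hV hnd hsmul hH v
  have hv0 : v ≠ 0 := fun h => h0 (h ▸ hv)
  have hnegv : -v ∈ S := by
    rw [← neg_one_smul F v]
    exact (hS _ (neg_ne_zero.2 one_ne_zero) v).2 hv
  have hsq : (fun w => g w ^ 2) = fun w => g w + if w = 0 then x ^ 2 + x else 0 := by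
    funext w
    by_cases hw : w = 0
    · subst hw
      simp [hgdef, h0]
    · by_cases hwS : w ∈ S <;> simp [hgdef, hw, hwS]
  rw [hsq, hypTransform_add_single, hH] at hconv
  have hgv : g (-v) = 1 := by simp [hgdef, hnegv, hv0]
  rw [hgv] at hconv
  have hprod : ∀ a, g a * g (v - a) = (if a ∈ S ∧ v - a ∈ S then 1 else 0) -
      (if a = 0 then x else 0) - if a = v then x else 0 := by
    intro a
    by_cases ha : a = 0
    · subst ha
      simp [hgdef, h0, hv, hv0, hv0.symm]
    · by_cases hav : a = v
      · subst hav
        simp [hgdef, h0, hv, hv0]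
      · have : v - a ≠ 0 := fun h => hav (sub_eq_zero.1 h).symm
        by_cases h1 : a ∈ S <;> by_cases h2 : v - a ∈ S <;> simp [hgdef, ha, hav, this, h1, h2]
  rw [Finset.sum_congr rfl fun a _ => hprod a, Finset.sum_sub_distrib, Finset.sum_sub_distrib,
    Finset.sum_ite_eq', Finset.sum_ite_eq', if_pos (Finset.mem_univ _),
    if_pos (Finset.mem_univ _), Finset.sum_boole] at hconv
  have := card_decompositions hS h0 hv
  linarith

end Bound

section Cone

variable {F V : Type} [Field F] [Fintype F] [AddCommGroup V] [Module F V] [Fintype V]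

/-- The non-zero vectors spanning a point of `O`. -/
def cone (O : Set (Projectivization F V)) : Set V :=
  {v | ∃ h : v ≠ 0, Projectivization.mk F v h ∈ O}

variable {O : Set (Projectivization F V)}

omit [Fintype F] [Fintype V] in
theorem exists_smul_rep {v : V} (hv : v ∈ cone O) : ∃ c : Fˣ, ∃ p ∈ O, c • p.rep = v := by
  obtain ⟨h, hO⟩ := hv
  obtain ⟨c, hc⟩ := Projectivization.exists_smul_eq_mk_rep F v h
  exact ⟨c⁻¹, _, hO, by rw [← hc, inv_smul_smul]⟩

omit [Fintype F] [Fintype V] in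
theorem mk_smul_rep (c : Fˣ) (p : Projectivization F V) (h : c • p.rep ≠ 0) :
    Projectivization.mk F (c • p.rep) h = p := by
  conv_rhs => rw [← p.mk_rep]
  rw [Projectivization.mk_eq_mk_iff']
  exact ⟨c, rfl⟩

omit [Fintype F] [Fintype V] in
theorem smul_rep_mem_cone (c : Fˣ) {p : Projectivization F V} (hp : p ∈ O) :
    c • p.rep ∈ cone O := by
  have h : c • p.rep ≠ 0 := (smul_ne_zero_iff_ne c).2 p.rep_nonzero
  exact ⟨h, by rwa [mk_smul_rep]⟩

omit [Fintype F] [Fintype V] in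
theorem smul_mem_cone (c : F) (hc : c ≠ 0) (v : V) : c • v ∈ cone O ↔ v ∈ cone O := by
  have key : ∀ (c : F), c ≠ 0 → ∀ v : V, v ∈ cone O → c • v ∈ cone O := by
    intro c hc v hv
    obtain ⟨d, p, hp, rfl⟩ := exists_smul_rep hv
    have : c • d • p.rep = (Units.mk0 c hc * d) • p.rep := by rw [mul_smul]; rfl
    rw [this]
    exact smul_rep_mem_cone _ hp
  refine ⟨fun h => ?_, key c hc v⟩
  have := key c⁻¹ (inv_ne_zero hc) _ h
  rwa [inv_smul_smul₀ hc] at this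

open Classical in
theorem card_cone_submodule (W : Submodule F V) :
    ((Finset.univ.filter fun v => v ∈ W ∧ v ∈ cone O).card : ℝ) =
      ((pts W ∩ O).ncard : ℝ) * ((Fintype.card F : ℝ) - 1) := by
  have himage : {v | v ∈ W ∧ v ∈ cone O} =
      (fun z : Fˣ × Projectivization F V => z.1 • z.2.rep) '' (Set.univ ×ˢ (pts W ∩ O)) := by
    ext v
    constructor
    · rintro ⟨hW, hv⟩
      obtain ⟨c, p, hp, rfl⟩ := exists_smul_rep hv
      refine ⟨(c, p), ⟨trivial, ?_, hp⟩, rfl⟩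
      exact (Submodule.smul_mem_iff_of_isUnit W c.isUnit).1 hW
    · rintro ⟨⟨c, p⟩, ⟨_, hW, hp⟩, rfl⟩
      exact ⟨W.smul_mem (c : F) hW, smul_rep_mem_cone c hp⟩
  have hinj : Function.Injective (fun z : Fˣ × Projectivization F V => z.1 • z.2.rep) := by
    rintro ⟨c, p⟩ ⟨d, p'⟩ h
    have hc : c • p.rep ≠ 0 := (smul_ne_zero_iff_ne c).2 p.rep_nonzero
    have hd : d • p'.rep ≠ 0 := (smul_ne_zero_iff_ne d).2 p'.rep_nonzero
    simp only at h
    obtain rfl : p = p' := by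
      rw [← mk_smul_rep c p hc, ← mk_smul_rep d p' hd]
      congr 1
    have : (c : F) = d := smul_left_injective F p.rep_nonzero h
    rw [Units.ext this]
  have hcard : (Finset.univ.filter fun v => v ∈ W ∧ v ∈ cone O).card =
      {v | v ∈ W ∧ v ∈ cone O}.ncard := by
    rw [← Set.ncard_coe_finset]
    simp
  rw [hcard, himage, Set.ncard_image_of_injective _ hinj, Set.ncard_prod, Set.ncard_univ,
    Nat.card_eq_fintype_card, Fintype.card_units, Nat.cast_mul, Nat.cast_sub Fintype.card_pos,
    Nat.cast_one, mul_comm]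

end Cone

/-- Theorem 4.3(1): if `O` is a non-trivial `m`-ovoid of the elliptic
quadric `Q⁻(2r+1,q)`, `r ≥ 2`, then `m ≥ (−3 + √(9 + 4(q^{r+1} + q − 2)))/(2(q−1))`. -/
theorem elliptic_ovoid_lower_bound
    {F : Type} [Field F] [Fintype F] {q r m : ℕ} (hq : Fintype.card F = q)
    (hr : 2 ≤ r) (P : PolarSpace F r PolarKind.elliptic)
    (O : Set (Projectivization F (Fin (PolarKind.elliptic.vdim r) → F)))
    (hO : P.IsNontrivialMOvoid m O) :
    (m : ℝ) ≥ (-3 + Real.sqrt (9 + 4 * ((q : ℝ) ^ (r + 1) + (q : ℝ) - 2)))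
        / (2 * ((q : ℝ) - 1)) := by
  classical
  obtain ⟨σ, B, hnd, sing, ti, hspec, hex, hle⟩ := P
  obtain ⟨rfl, Q, hpol, rfl, hti⟩ := hspec
  obtain ⟨⟨hsub, hgen⟩, hm, -⟩ := hO
  have : Fintype (Fin (PolarKind.elliptic.vdim r) → F) := Fintype.ofFinite _
  have hti' : ∀ W, ti W ↔ TotSing Q W := hti
  obtain ⟨G, hG, hGr⟩ := hex
  have hne : (pts G ∩ O).Nonempty := by
    apply Set.nonempty_of_ncard_ne_zero
    rw [hgen G ⟨hG, hGr⟩]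
    exact hm.ne'
  obtain ⟨p, -, hp⟩ := hne
  have hbound := cone_bound (Q := Q) (r := r) (S := cone O)
    (x := (m : ℝ) * ((Fintype.card F : ℝ) - 1)) (v := (1 : Fˣ) • p.rep)
    (Module.finrank_fin_fun F)
    (fun v hv => hnd v fun w => by rw [← hpol]; exact hv w)
    ⟨G, (hti' G).1 hG, hGr⟩ (fun W hW => hle W ((hti' W).2 hW))
    smul_mem_cone (fun h => h.1 rfl)
    (by
      intro v hv
      obtain ⟨c, p, hp, rfl⟩ := exists_smul_rep hv
      have hQ : Q p.rep = 0 := hsub hp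
      rw [Units.smul_def, QuadraticMap.map_smul, hQ, smul_zero])
    (by
      intro W hW hWr
      rw [card_cone_submodule, hgen W ⟨(hti' W).2 hW, hWr⟩])
    (smul_rep_mem_cone 1 hp)
  have hpos := card_sub_one_pos (F := F)
  rw [hq] at hbound hpos
  rw [ge_iff_le, div_le_iff₀ (by linarith)]
  have hx : 0 ≤ (m : ℝ) * ((q : ℝ) - 1) := by positivity
  have hsqrt : Real.sqrt (9 + 4 * ((q : ℝ) ^ (r + 1) + (q : ℝ) - 2)) ≤
      2 * ((m : ℝ) * ((q : ℝ) - 1)) + 3 := by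
    apply Real.sqrt_le_iff.2
    exact ⟨by linarith, by nlinarith⟩
  linarith

end PolarOvoids
end
end

section
/- Let O be a non-trivial m-ovoid of the Hermitian polar space H(4,q²) with weight function μ, and fix a point p₀ ∈ O. Then Σ_{p ∈ H(4,q²)∖{p₀}} μ(p)·μ(⟨p₀,p⟩) ≥ m(m−1)(q³+1) + 2(m·q³(q²−1) + q³), where the sum is over the points of H(4,q²) other than p₀ and ⟨p₀,p⟩ denotes the projective line through p₀ and p. -/
noncomputable section

open scoped BigOperators

namespace PolarOvoids

open scoped Classical in
/-- Every fibre of the trace `x ↦ x + σ x` over an element fixed by the involution `σ` of the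
field of order `q²` has `q` elements. -/
theorem card_trace_fiber {F : Type} [Field F] [Fintype F] {q : ℕ}
    (hq : Fintype.card F = q ^ 2) {σ : F →+* F} (hσ : σ ≠ RingHom.id F)
    (hσσ : ∀ x, σ (σ x) = x) {k : F} (hk : σ k = k) :
    (Finset.univ.filter fun x : F => x + σ x = k).card = q := by
  obtain ⟨a, ha⟩ : ∃ a, σ a ≠ a := by
    by_contra! h
    exact hσ (RingHom.ext h)
  obtain ⟨b, hb⟩ : ∃ b, b + σ b ≠ 0 := by
    by_contra! h
    have h1 : (1 : F) + 1 = 0 := by simpa using h 1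
    exact ha (by linear_combination h a - a * h1)
  have hd : a - σ a ≠ 0 := fun h => ha (sub_eq_zero.mp h).symm
  set K := Finset.univ.filter fun x : F => σ x = x
  have hker : (Finset.univ.filter fun x : F => x + σ x = 0).card = K.card := by
    refine Finset.card_bij' (fun x _ => x / (a - σ a)) (fun x _ => x * (a - σ a)) ?_ ?_ ?_ ?_
    · intro x hx
      simp only [K, Finset.mem_filter, Finset.mem_univ, true_and, map_div₀, map_sub, hσσ] at hx ⊢
      rw [← neg_sub a, div_neg, ← neg_div, eq_neg_of_add_eq_zero_right hx, neg_neg]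
    · intro x hx
      simp only [K, Finset.mem_filter, Finset.mem_univ, true_and, map_mul, map_sub, hσσ] at hx ⊢
      rw [hx]; ring
    · intro x _
      exact div_mul_cancel₀ x hd
    · intro x _
      exact mul_div_cancel_right₀ x hd
  have hfib : ∀ k ∈ K, (Finset.univ.filter fun x : F => x + σ x = k).card = K.card := by
    intro k hk
    have hk : σ k = k := by simpa [K] using hk
    obtain ⟨c, hc⟩ : ∃ c, c + σ c = k := by
      refine ⟨k * b / (b + σ b), ?_⟩
      simp only [map_div₀, map_mul, map_add, hσσ, hk]
      rw [add_comm (σ b) b, ← add_div, ← mul_add, mul_div_cancel_right₀ _ hb]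
    rw [← hker]
    refine Finset.card_bij' (fun x _ => x - c) (fun x _ => x + c) ?_ ?_ ?_ ?_
    · intro x hx
      simp only [Finset.mem_filter, Finset.mem_univ, true_and, map_sub] at hx ⊢
      linear_combination hx - hc
    · intro x hx
      simp only [Finset.mem_filter, Finset.mem_univ, true_and, map_add] at hx ⊢
      linear_combination hx + hc
    · intro x _; simp
    · intro x _; simp
  have hcard := Finset.card_eq_sum_card_fiberwise (s := Finset.univ) (t := K)
    (f := fun x : F => x + σ x) (by
      intro x _
      simp [K, hσσ, add_comm])
  rw [Finset.sum_congr rfl hfib, Finset.card_univ, hq, Finset.sum_const, smul_eq_mul, ← sq] at hcard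
  rw [hfib k (by simpa [K] using hk)]
  exact (Nat.pow_left_injective (n := 2) two_ne_zero hcard).symm

section LinearAlgebra

variable {F V : Type} [Field F] [AddCommGroup V] [Module F V]

theorem mem_span_sup_exchange {f x y : V}
    (hy : y ∈ Submodule.span F {f} ⊔ Submodule.span F {x}) (hyf : y ∉ Submodule.span F {f}) :
    x ∈ Submodule.span F {f} ⊔ Submodule.span F {y} := by
  rw [sup_comm, ← Submodule.span_insert] at hy ⊢
  exact mem_span_insert_exchange hy hyf

theorem finrank_span_sup_span {f x : V} (hf : f ≠ 0) (hx : x ∉ Submodule.span F {f}) :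
    Module.finrank F ↥(Submodule.span F {f} ⊔ Submodule.span F {x}) = 2 := by
  have hli : LinearIndependent F ![f, x] := by
    rw [LinearIndependent.pair_iff' hf]
    intro a ha
    exact hx (Submodule.mem_span_singleton.mpr ⟨a, ha⟩)
  have h := finrank_span_eq_card hli
  rwa [Matrix.range_cons, Matrix.range_cons, Matrix.range_empty, Set.union_empty,
    Submodule.span_union, Fintype.card_fin] at h

theorem span_sup_span_eq {W : Submodule F V} (hW : Module.finrank F ↥W = 2) {f x : V}
    (hf : f ≠ 0) (hfW : f ∈ W) (hxW : x ∈ W) (hx : x ∉ Submodule.span F {f}) :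
    Submodule.span F {f} ⊔ Submodule.span F {x} = W := by
  have : FiniteDimensional F ↥W := Module.finite_of_finrank_pos (by omega)
  refine Submodule.eq_of_le_of_finrank_eq ?_ (by rw [finrank_span_sup_span hf hx, hW])
  rw [sup_le_iff, Submodule.span_singleton_le_iff_mem, Submodule.span_singleton_le_iff_mem]
  exact ⟨hfW, hxW⟩

theorem exists_mem_notMem_span {W : Submodule F V} (hW : Module.finrank F ↥W = 2) (f : V) :
    ∃ x ∈ W, x ∉ Submodule.span F {f} := by
  by_contra! h
  have h1 := Submodule.finrank_mono (R := F) (show W ≤ Submodule.span F {f} from h)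
  have h2 := finrank_span_le_card (R := F) ({f} : Set V)
  simp at h2
  omega

theorem eq_of_rep_mem_span {y z : Projectivization F V}
    (h : y.rep ∈ Submodule.span F {z.rep}) : y = z := by
  obtain ⟨a, ha⟩ := Submodule.mem_span_singleton.mp h
  rw [← y.mk_rep, ← z.mk_rep, Projectivization.mk_eq_mk_iff']
  exact ⟨a, ha⟩

open scoped Classical in
theorem card_filter_mem [Fintype F] [Fintype V] (W : Submodule F V) :
    (Finset.univ.filter fun x : V => x ∈ W).card = Fintype.card F ^ Module.finrank F ↥W := by
  rw [← Module.card_eq_pow_finrank (K := F) (V := ↥W), Fintype.card_subtype]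

open scoped Classical in
theorem card_points [Fintype F] [Fintype (Projectivization F V)]
    {W : Submodule F V} (hW : Module.finrank F ↥W = 2) :
    (Finset.univ.filter fun p : Projectivization F V => p.rep ∈ W).card
      = Fintype.card F + 1 := by
  have hinj := Projectivization.map_injective W.subtype W.injective_subtype
  have hfin : Finite (Projectivization F ↥W) := Finite.of_injective _ hinj
  have := Fintype.ofFinite (Projectivization F ↥W)
  rw [← Nat.card_eq_fintype_card (α := F), ← Projectivization.card_of_finrank_two F ↥W hW,
    Nat.card_eq_fintype_card, ← Finset.card_univ, ← Finset.card_image_of_injective _ hinj]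
  congr 1
  ext p
  simp only [Finset.mem_filter, Finset.mem_univ, true_and, Finset.mem_image]
  constructor
  · intro hp
    refine ⟨Projectivization.mk F ⟨p.rep, hp⟩ fun h => p.rep_nonzero (congrArg Subtype.val h), ?_⟩
    rw [Projectivization.map_mk]
    exact p.mk_rep
  · rintro ⟨x, rfl⟩
    induction x using Projectivization.ind with
    | h v hv =>
      rw [Projectivization.map_mk]
      obtain ⟨a, ha⟩ := Projectivization.exists_smul_eq_mk_rep F (W.subtype v)
        (by simpa using hv)
      rw [← ha]
      exact W.smul_mem _ v.2

end LinearAlgebra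

section HermitianForm

variable {F V : Type} [Field F] [AddCommGroup V] [Module F V] {σ : F →+* F}

/-- All vectors of `W` are pairwise orthogonal with respect to `B`. -/
def TotallyIsotropic (B : V →ₗ[F] V →ₛₗ[σ] F) (W : Submodule F V) : Prop :=
  ∀ v ∈ W, ∀ w ∈ W, B v w = 0

/-- `B` is a non-degenerate Hermitian form on a five-dimensional space all of whose totally
isotropic subspaces have dimension at most two. -/
structure IsHermitianH4 (B : V →ₗ[F] V →ₛₗ[σ] F) : Prop where
  ne_id : σ ≠ RingHom.id F
  invol : ∀ x, σ (σ x) = x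
  herm : ∀ v w, B w v = σ (B v w)
  nondeg : ∀ v, (∀ w, B v w = 0) → v = 0
  finrank_eq : Module.finrank F V = 5
  rank_le : ∀ W : Submodule F V, TotallyIsotropic B W → Module.finrank F ↥W ≤ 2

variable {B : V →ₗ[F] V →ₛₗ[σ] F}

theorem form_eq_zero_of_mem_sup {u w x y : V} (hu : B u y = 0) (hw : B w y = 0)
    (hx : x ∈ Submodule.span F {u} ⊔ Submodule.span F {w}) : B x y = 0 := by
  obtain ⟨a, ha, b, hb, rfl⟩ := Submodule.mem_sup.mp hx
  obtain ⟨s, rfl⟩ := Submodule.mem_span_singleton.mp ha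
  obtain ⟨t, rfl⟩ := Submodule.mem_span_singleton.mp hb
  simp [hu, hw]

namespace IsHermitianH4

variable (hB : IsHermitianH4 B)
include hB

theorem finiteDimensional : FiniteDimensional F V :=
  Module.finite_of_finrank_pos (by rw [hB.finrank_eq]; norm_num)

theorem symm_zero {v w : V} (h : B v w = 0) : B w v = 0 := by
  rw [hB.herm, h, map_zero]

theorem mem_of_perp {W : Submodule F V} (hW : TotallyIsotropic B W)
    (hW2 : Module.finrank F ↥W = 2) {x : V} (hx : B x x = 0) (hWx : ∀ w ∈ W, B w x = 0) :
    x ∈ W := by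
  have := hB.finiteDimensional
  have hti : TotallyIsotropic B (W ⊔ Submodule.span F {x}) := by
    intro v hv w hw
    obtain ⟨a, ha, b, hb, rfl⟩ := Submodule.mem_sup.mp hv
    obtain ⟨c, hc, d, hd, rfl⟩ := Submodule.mem_sup.mp hw
    obtain ⟨s, rfl⟩ := Submodule.mem_span_singleton.mp hb
    obtain ⟨t, rfl⟩ := Submodule.mem_span_singleton.mp hd
    simp [hW a ha c hc, hWx a ha, hB.symm_zero (hWx c hc), hx]
  have h := Submodule.eq_of_le_of_finrank_le (le_sup_left : W ≤ W ⊔ Submodule.span F {x})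
    (by rw [hW2]; exact hB.rank_le _ hti)
  rw [h]
  exact Submodule.mem_sup_right (Submodule.mem_span_singleton_self x)

theorem totallyIsotropic_sup {u w : V} (hu : B u u = 0) (hw : B w w = 0) (huw : B u w = 0) :
    TotallyIsotropic B (Submodule.span F {u} ⊔ Submodule.span F {w}) := by
  have key : ∀ y, B u y = 0 → B w y = 0 →
      ∀ x ∈ Submodule.span F {u} ⊔ Submodule.span F {w}, B x y = 0 :=
    fun y h1 h2 x hx => form_eq_zero_of_mem_sup h1 h2 hx
  intro v hv z hz
  exact form_eq_zero_of_mem_sup (hB.symm_zero (key u hu (hB.symm_zero huw) z hz))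
    (hB.symm_zero (key w huw hw z hz)) hv

/-- Every isotropic vector lies in a totally isotropic plane. -/
theorem exists_line (hex : ∃ W : Submodule F V, TotallyIsotropic B W ∧ Module.finrank F ↥W = 2)
    {e : V} (he : e ≠ 0) (hee : B e e = 0) :
    ∃ W : Submodule F V, TotallyIsotropic B W ∧ Module.finrank F ↥W = 2 ∧ e ∈ W := by
  obtain ⟨W, hW, hW2⟩ := hex
  by_cases heW : e ∈ W
  · exact ⟨W, hW, hW2, heW⟩
  have := hB.finiteDimensional
  have hker : 0 < Module.finrank F ↥(LinearMap.ker ((B.flip e).domRestrict W)) := by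
    have h1 := LinearMap.finrank_range_add_finrank_ker ((B.flip e).domRestrict W)
    have h2 := Submodule.finrank_le (LinearMap.range ((B.flip e).domRestrict W))
    rw [Module.finrank_self] at h2
    omega
  obtain ⟨⟨⟨w, hw⟩, hwk⟩, hw0⟩ := Module.finrank_pos_iff_exists_ne_zero.mp hker
  have hwe : B w e = 0 := by simpa using hwk
  have hw0 : w ≠ 0 := fun h => hw0 (by ext; simpa using h)
  refine ⟨_, hB.totallyIsotropic_sup hee (hW w hw w hw) (hB.symm_zero hwe),
    finrank_span_sup_span he fun h => ?_,
    Submodule.mem_sup_left (Submodule.mem_span_singleton_self e)⟩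
  obtain ⟨a, rfl⟩ := Submodule.mem_span_singleton.mp h
  have ha : a ≠ 0 := fun h => hw0 (by simp [h])
  exact heW ((W.smul_mem_iff ha).mp hw)

theorem exists_form_ne_zero {v : V} (hv : v ≠ 0) : ∃ u, B u v ≠ 0 := by
  by_contra! h
  exact hv (hB.nondeg v fun w => hB.symm_zero (h w))

theorem exists_perp_form_ne_zero {f e : V} (hf : f ≠ 0) (he : e ∉ Submodule.span F {f}) :
    ∃ u, B u f = 0 ∧ B u e ≠ 0 := by
  by_contra! h
  obtain ⟨u, hu⟩ := hB.exists_form_ne_zero hf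
  refine he (Submodule.mem_span_singleton.mpr ⟨σ (B u e / B u f), ?_⟩)
  by_contra hne
  obtain ⟨v, hv⟩ := hB.exists_form_ne_zero (sub_ne_zero.mpr hne)
  have h1 := h (v - (B v f / B u f) • u) (by simp [hu])
  apply hv
  simp only [map_sub, map_smulₛₗ, hB.invol, LinearMap.sub_apply, LinearMap.smul_apply,
    smul_eq_mul, RingHom.id_apply] at h1 ⊢
  field_simp at h1 ⊢
  linear_combination -h1

open scoped Classical in
theorem card_perp_diff [Fintype F] [Fintype V] {f e : V} (hf : f ≠ 0)
    (he : e ∉ Submodule.span F {f}) :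
    (Finset.univ.filter fun x : V => B x f = 0 ∧ B x e ≠ 0).card + Fintype.card F ^ 3
      = Fintype.card F ^ 4 := by
  have := hB.finiteDimensional
  set H := LinearMap.ker (B.flip f)
  have hH : Module.finrank F ↥H = 4 := by
    have h : Module.finrank F ↥H + 1 = Module.finrank F V :=
      Module.Dual.finrank_ker_add_one_of_ne_zero (f := B.flip f) (by
      obtain ⟨u, hu⟩ := hB.exists_form_ne_zero hf
      exact fun h0 => hu (by simpa using LinearMap.congr_fun h0 u))
    rw [hB.finrank_eq] at h
    omega
  set g := (B.flip e).domRestrict H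
  have hg : Module.finrank F ↥(LinearMap.ker g) = 3 := by
    have h : Module.finrank F ↥(LinearMap.ker g) + 1 = Module.finrank F ↥H :=
      Module.Dual.finrank_ker_add_one_of_ne_zero (f := g) (by
      obtain ⟨u, hu, hue⟩ := hB.exists_perp_form_ne_zero hf he
      exact fun h0 => hue (by simpa [g] using LinearMap.congr_fun h0 ⟨u, by simpa [H] using hu⟩))
    rw [hH] at h
    omega
  have hK : Module.finrank F ↥((LinearMap.ker g).map H.subtype) = 3 := by
    rw [← hg]
    exact Submodule.finrank_map_subtype_eq H _
  rw [← hK, ← hH, ← card_filter_mem, ← card_filter_mem, ← Finset.card_union_of_disjoint]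
  · congr 1
    ext x
    simp only [Finset.mem_union, Finset.mem_filter, Finset.mem_univ, true_and, H, g,
      Submodule.mem_map, LinearMap.mem_ker]
    by_cases h : B x e = 0 <;> simp [h]
  · rw [Finset.disjoint_left]
    intro x hx hx'
    simp only [Finset.mem_filter, Finset.mem_univ, true_and, g, H,
      Submodule.mem_map, LinearMap.mem_ker] at hx hx'
    obtain ⟨y, hy, rfl⟩ := hx'
    exact hx.2 (by simpa using hy)

open scoped Classical in
theorem card_isotropic_perp [Fintype F] [Fintype V] {q : ℕ} (hq : Fintype.card F = q ^ 2)
    {W : Submodule F V} (hW : TotallyIsotropic B W) (hW2 : Module.finrank F ↥W = 2)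
    {f : V} (hf : f ≠ 0) (hfW : f ∈ W) :
    (Finset.univ.filter fun x : V => B x f = 0 ∧ B x x = 0 ∧ x ∉ W).card + q ^ 5 = q ^ 7 := by
  obtain ⟨e, heW, he⟩ := exists_mem_notMem_span hW2 f
  have hspan := span_sup_span_eq hW2 hf hfW heW he
  set X := Finset.univ.filter fun x : V => B x f = 0 ∧ B x e ≠ 0
  have hX : X.card + q ^ 6 = q ^ 8 := by
    have h := hB.card_perp_diff hf he
    rw [hq] at h
    rwa [← pow_mul, ← pow_mul] at h
  have hS : (Finset.univ.filter fun x : V => B x f = 0 ∧ B x x = 0 ∧ x ∉ W)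
      = Finset.univ.filter fun x : V => B x f = 0 ∧ B x x = 0 ∧ B x e ≠ 0 := by
    refine Finset.filter_congr fun x _ => and_congr_right fun hxf => and_congr_right fun hxx => ?_
    refine not_congr ⟨fun h => hW x h e heW, fun h => hB.mem_of_perp hW hW2 hxx fun w hw => ?_⟩
    rw [← hspan] at hw
    exact form_eq_zero_of_mem_sup (hB.symm_zero hxf) (hB.symm_zero h) hw
  rw [hS]
  set S := Finset.univ.filter fun x : V => B x f = 0 ∧ B x x = 0 ∧ B x e ≠ 0
  have hfe := hW f hfW e heW
  have hef := hW e heW f hfW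
  have hee := hW e heW e heW
  have hcount : X.card * q = (Finset.univ : Finset F).card * S.card := by
    refine Finset.card_mul_eq_card_mul
      (fun (x : V) (c : F) => B (x + c • e) (x + c • e) = 0) ?_ ?_
    · intro x hx
      simp only [X, Finset.mem_filter, Finset.mem_univ, true_and] at hx
      have hne : B e x ≠ 0 := fun h => hx.2 (hB.symm_zero h)
      rw [← card_trace_fiber hq hB.ne_id hB.invol (k := -B x x)
        (by rw [map_neg, ← hB.herm])]
      refine Finset.card_bij' (fun c _ => c * B e x) (fun t _ => t / B e x) ?_ ?_ ?_ ?_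
      · intro c hc
        simp only [Finset.mem_bipartiteAbove, Finset.mem_filter, Finset.mem_univ, true_and,
          map_add, map_smulₛₗ, LinearMap.add_apply, LinearMap.smul_apply, smul_eq_mul, hee,
          RingHom.id_apply, map_mul, ← hB.herm e x] at hc ⊢
        linear_combination hc
      · intro t ht
        have h1 : B x e = σ (B e x) := hB.herm e x
        have h2 : σ (B e x) ≠ 0 := by rw [← h1]; exact hx.2
        simp only [Finset.mem_bipartiteAbove, Finset.mem_filter, Finset.mem_univ, true_and,
          map_add, map_smulₛₗ, LinearMap.add_apply, LinearMap.smul_apply, smul_eq_mul, hee,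
          RingHom.id_apply, map_div₀, h1, div_mul_cancel₀ _ hne] at ht ⊢
        linear_combination ht + div_mul_cancel₀ (σ t) h2
      · intro c _
        exact mul_div_cancel_right₀ c hne
      · intro t _
        exact div_mul_cancel₀ t hne
    · intro c _
      refine Finset.card_bij' (fun x _ => x + c • e) (fun x _ => x - c • e) ?_ ?_ ?_ ?_
      · intro x hx
        simp only [Finset.mem_bipartiteBelow, X, S, Finset.mem_filter, Finset.mem_univ,
          true_and] at hx ⊢
        refine ⟨?_, hx.2, ?_⟩
        · simp [hx.1.1, hef]
        · simpa [hee] using hx.1.2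
      · intro x hx
        simp only [Finset.mem_bipartiteBelow, X, S, Finset.mem_filter, Finset.mem_univ,
          true_and, sub_add_cancel] at hx ⊢
        refine ⟨⟨?_, ?_⟩, hx.2.1⟩
        · simp [hx.1, hef]
        · simpa [hee] using hx.2.2
      · intro x _; simp
      · intro x _; simp
  rw [Finset.card_univ, hq] at hcount
  have hq0 : 0 < q ^ 2 := by rw [← hq]; exact Fintype.card_pos
  refine Nat.eq_of_mul_eq_mul_left hq0 ?_
  linear_combination q * hX - hcount

variable {O : Finset (Projectivization F V)} {m : ℕ}

open scoped Classical in
/-- The points of an `m`-ovoid that are collinear with the point `z` of a generator `W` but do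
not lie on `W`. -/
theorem card_collinear_off_line [Fintype F] [Fintype V] {q : ℕ} (hq : Fintype.card F = q ^ 2)
    (hO : ∀ p ∈ O, B p.rep p.rep = 0)
    (hm : ∀ W : Submodule F V, TotallyIsotropic B W → Module.finrank F ↥W = 2 →
      (O.filter fun p => p.rep ∈ W).card = m)
    {W : Submodule F V} (hW : TotallyIsotropic B W) (hW2 : Module.finrank F ↥W = 2)
    {z : Projectivization F V} (hz : z.rep ∈ W) :
    (O.filter fun y => B y.rep z.rep = 0 ∧ y.rep ∉ W).card
      = q ^ 3 * ((O.filter fun p => p.rep ∈ W).erase z).card := by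
  set f := z.rep
  have hf : f ≠ 0 := z.rep_nonzero
  have hff : B f f = 0 := hW f hz f hz
  set S := Finset.univ.filter fun x : V => B x f = 0 ∧ B x x = 0 ∧ x ∉ W
  have hS : S.card + q ^ 5 = q ^ 7 := hB.card_isotropic_perp hq hW hW2 hf hz
  set C := O.filter fun y => B y.rep f = 0 ∧ y.rep ∉ W
  have hfW : Submodule.span F {f} ≤ W := (Submodule.span_singleton_le_iff_mem _ _).mpr hz
  have hle : ∀ {x : V}, x ∈ W → Submodule.span F {f} ⊔ Submodule.span F {x} ≤ W := fun hx =>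
    sup_le hfW ((Submodule.span_singleton_le_iff_mem _ _).mpr hx)
  have hcount : S.card * ((O.filter fun p => p.rep ∈ W).erase z).card
      = C.card * (q ^ 4 - q ^ 2) := by
    refine Finset.card_mul_eq_card_mul
      (fun (x : V) (y : Projectivization F V) =>
        y.rep ∈ Submodule.span F {f} ⊔ Submodule.span F {x}) ?_ ?_
    · intro x hx
      simp only [S, Finset.mem_filter, Finset.mem_univ, true_and] at hx
      have hxf : x ∉ Submodule.span F {f} := fun h => hx.2.2 (hfW h)
      have hti := hB.totallyIsotropic_sup hff hx.2.1 (hB.symm_zero hx.1)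
      have hfx : f ∈ Submodule.span F {f} ⊔ Submodule.span F {x} :=
        Submodule.mem_sup_left (Submodule.mem_span_singleton_self f)
      have heq : C.bipartiteAbove (fun (x : V) (y : Projectivization F V) =>
          y.rep ∈ Submodule.span F {f} ⊔ Submodule.span F {x}) x
          = (O.filter fun p =>
            p.rep ∈ Submodule.span F {f} ⊔ Submodule.span F {x}).erase z := by
        ext y
        simp only [C, Finset.mem_bipartiteAbove, Finset.mem_filter, Finset.mem_erase]
        constructor
        · rintro ⟨⟨hyO, _, hyW⟩, hy⟩
          exact ⟨fun h => hyW (h ▸ hz), hyO, hy⟩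
        · rintro ⟨hyz, hyO, hy⟩
          refine ⟨⟨hyO, hti _ hy _ hfx, fun hyW => hx.2.2 ?_⟩, hy⟩
          exact hle hyW (mem_span_sup_exchange hy fun h => hyz (eq_of_rep_mem_span h))
      rw [heq, Finset.card_erase_eq_ite, Finset.card_erase_eq_ite, hm W hW hW2,
        hm _ hti (finrank_span_sup_span hf hxf)]
      simp only [Finset.mem_filter]
      change (if z ∈ O ∧ f ∈ _ then _ else _) = if z ∈ O ∧ f ∈ W then _ else _
      simp [hfx, hz]
    · intro y hy
      simp only [C, Finset.mem_filter] at hy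
      have hyf : y.rep ∉ Submodule.span F {f} := fun h => hy.2.2 (hfW h)
      have hti := hB.totallyIsotropic_sup hff (hO y hy.1) (hB.symm_zero hy.2.1)
      have heq : S.bipartiteBelow (fun (x : V) (y : Projectivization F V) =>
          y.rep ∈ Submodule.span F {f} ⊔ Submodule.span F {x}) y
          = (Finset.univ.filter fun x =>
              x ∈ Submodule.span F {f} ⊔ Submodule.span F {y.rep}) \
            Finset.univ.filter fun x => x ∈ Submodule.span F {f} := by
        ext x
        simp only [S, Finset.mem_bipartiteBelow, Finset.mem_filter, Finset.mem_univ, true_and,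
          Finset.mem_sdiff]
        constructor
        · rintro ⟨⟨_, _, hxW⟩, hx⟩
          exact ⟨mem_span_sup_exchange hx hyf, fun h => hxW (hfW h)⟩
        · rintro ⟨hx, hxf⟩
          have hyx := mem_span_sup_exchange hx hxf
          exact ⟨⟨hti _ hx _ (Submodule.mem_sup_left (Submodule.mem_span_singleton_self f)),
            hti _ hx _ hx, fun h => hy.2.2 (hle h hyx)⟩, hyx⟩
      rw [heq, Finset.card_sdiff_of_subset, card_filter_mem, card_filter_mem,
        finrank_span_sup_span hf hyf, finrank_span_singleton hf, hq]
      · ring_nf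
      · intro x
        simp only [Finset.mem_filter, Finset.mem_univ, true_and]
        exact fun h => Submodule.mem_sup_left h
  have hq1 : 1 < q ^ 2 := by rw [← hq]; exact Fintype.one_lt_card
  have hpos : 0 < q ^ 4 - q ^ 2 := by
    have : q ^ 4 = q ^ 2 * q ^ 2 := by ring
    rw [this, Nat.sub_pos_iff_lt]
    nlinarith
  refine Nat.eq_of_mul_eq_mul_right hpos ?_
  rw [← hcount, mul_right_comm, Nat.mul_sub]
  congr 1
  have h5 : q ^ 3 * q ^ 2 = q ^ 5 := by ring
  have h7 : q ^ 3 * q ^ 4 = q ^ 7 := by ring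
  omega

open scoped Classical in
/-- An `m`-ovoid has at least `m q⁵` points off a generator. -/
theorem card_off_line_ge [Fintype F] [Fintype V] {q : ℕ} (hq : Fintype.card F = q ^ 2)
    (hO : ∀ p ∈ O, B p.rep p.rep = 0)
    (hm : ∀ W : Submodule F V, TotallyIsotropic B W → Module.finrank F ↥W = 2 →
      (O.filter fun p => p.rep ∈ W).card = m)
    {W : Submodule F V} (hW : TotallyIsotropic B W) (hW2 : Module.finrank F ↥W = 2) :
    m * q ^ 5 ≤ (O.filter fun y => y.rep ∉ W).card := by
  have := Fintype.ofFinite (Projectivization F V)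
  set L := Finset.univ.filter fun p : Projectivization F V => p.rep ∈ W
  have hL : L.card = q ^ 2 + 1 := by rw [← hq]; exact card_points hW2
  have hdisj : (L : Set (Projectivization F V)).PairwiseDisjoint
      fun z => O.filter fun y => B y.rep z.rep = 0 ∧ y.rep ∉ W := by
    intro z hz z' hz' hne
    have hzW : z.rep ∈ W := by simpa [L] using hz
    have hzW' : z'.rep ∈ W := by simpa [L] using hz'
    refine Finset.disjoint_left.mpr fun y hy hy' => ?_
    rw [Finset.mem_filter] at hy hy'
    refine hy.2.2 (hB.mem_of_perp hW hW2 (hO y hy.1) fun w hw => ?_)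
    rw [← span_sup_span_eq hW2 z.rep_nonzero hzW hzW'
      fun h => hne (eq_of_rep_mem_span h).symm] at hw
    exact form_eq_zero_of_mem_sup (hB.symm_zero hy.2.1) (hB.symm_zero hy'.2.1) hw
  have hsub : L.biUnion (fun z => O.filter fun y => B y.rep z.rep = 0 ∧ y.rep ∉ W)
      ⊆ O.filter fun y => y.rep ∉ W := by
    intro y
    simp only [Finset.mem_biUnion, Finset.mem_filter]
    rintro ⟨z, _, hy, _, hyW⟩
    exact ⟨hy, hyW⟩
  refine le_trans ?_ (Finset.card_le_card hsub)
  rw [Finset.card_biUnion hdisj, Finset.sum_congr rfl fun z hz =>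
    hB.card_collinear_off_line hq hO hm hW hW2 (z := z) (by simpa [L] using hz), ← Finset.mul_sum]
  have hsum : ∑ z ∈ L, ((O.filter fun p => p.rep ∈ W).erase z).card + m = (q ^ 2 + 1) * m := by
    have hOL : L.filter (fun z => z ∈ O.filter fun p => p.rep ∈ W)
        = O.filter fun p => p.rep ∈ W := by
      ext z
      simp only [L, Finset.mem_filter, Finset.mem_univ, true_and]
      tauto
    have h1 : ∑ z ∈ L, (if z ∈ O.filter fun p => p.rep ∈ W then 1 else 0) = m := by
      rw [← Finset.card_filter, hOL, hm W hW hW2]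
    nth_rewrite 1 [← h1]
    rw [← Finset.sum_add_distrib, ← hL, ← smul_eq_mul, ← Finset.sum_const]
    refine Finset.sum_congr rfl fun z _ => ?_
    split_ifs with h
    · rw [Finset.card_erase_add_one h, hm W hW hW2]
    · rw [Finset.erase_eq_of_notMem h, hm W hW hW2, add_zero]
  have h2 : ∑ z ∈ L, ((O.filter fun p => p.rep ∈ W).erase z).card = q ^ 2 * m := by
    linarith
  rw [h2]
  exact (by ring : m * q ^ 5 = q ^ 3 * (q ^ 2 * m)).le

end IsHermitianH4

end HermitianForm

theorem PolarSpace.isHermitianH4 {F : Type} [Field F] (P : PolarSpace F 2 PolarKind.hermitian) :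
    IsHermitianH4 P.B := by
  obtain ⟨h1, h2, h3, _, h5⟩ := P.spec
  exact ⟨h1, fun x => RingHom.congr_fun h2 x, h3, P.nondeg,
    by rw [Module.finrank_fin_fun]; rfl, fun W hW => P.rank_le W ((h5 W).mpr hW)⟩

theorem nwt_nonneg {X : Type} (O S : Set X) : 0 ≤ nwt O S := Nat.cast_nonneg _

theorem nwt_singleton {X : Type} {O : Set X} {p : X} (hp : p ∈ O) : nwt O {p} = 1 := by
  rw [nwt, Set.inter_eq_left.mpr (Set.singleton_subset_iff.mpr hp), Set.ncard_singleton,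
    Nat.cast_one]

/-- Lemma 4.5: if `O` is a non-trivial `m`-ovoid of the Hermitian polar
space `H(4,q²)` with weight function `μ` and `p₀ ∈ O`, then
`Σ_{p ∈ H(4,q²)∖{p₀}} μ(p)·μ(⟨p₀,p⟩) ≥ m(m−1)(q³+1) + 2(m·q³(q²−1) + q³)`. -/
theorem hermitian_H4_line_weight_sum_lower_bound
    {F : Type} [Field F] [Fintype F] {q m : ℕ} (hq : Fintype.card F = q ^ 2)
    (P : PolarSpace F 2 PolarKind.hermitian)
    (O : Set (Projectivization F (Fin (PolarKind.hermitian.vdim 2) → F)))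
    (hO : P.IsNontrivialMOvoid m O)
    (p₀ : Projectivization F (Fin (PolarKind.hermitian.vdim 2) → F)) (hp₀ : p₀ ∈ O) :
    ∑ᶠ p ∈ P.sing \ {p₀},
        nwt O {p} *
          nwt O (pts (Submodule.span F {p₀.rep} ⊔ Submodule.span F {p.rep}))
      ≥ (m : ℝ) * ((m : ℝ) - 1) * ((q : ℝ) ^ 3 + 1) +
        2 * ((m : ℝ) * (q : ℝ) ^ 3 * ((q : ℝ) ^ 2 - 1) + (q : ℝ) ^ 3) := by
  classical
  have hB := P.isHermitianH4
  obtain ⟨_, _, _, hsing, hti⟩ := P.spec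
  obtain ⟨⟨hOs, hgen⟩, _, _⟩ := hO
  have := Fintype.ofFinite (Projectivization F (Fin (PolarKind.hermitian.vdim 2) → F))
  have hOB : ∀ p ∈ O.toFinset, P.B p.rep p.rep = 0 := by
    intro p hp
    have := hOs (Set.mem_toFinset.mp hp)
    rwa [hsing] at this
  have hm : ∀ W, TotallyIsotropic P.B W → Module.finrank F ↥W = 2 →
      (O.toFinset.filter fun p => p.rep ∈ W).card = m := by
    intro W hW hW2
    rw [← hgen W ⟨(hti W).mpr hW, hW2⟩, Set.ncard_eq_toFinset_card']
    congr 1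
    ext p
    rw [Finset.mem_filter, Set.mem_toFinset, Set.mem_toFinset, and_comm]
    rfl
  have hp₀' : p₀ ∈ O.toFinset := Set.mem_toFinset.mpr hp₀
  obtain ⟨W, hW, hW2, hpW⟩ := hB.exists_line
    (by
      obtain ⟨W, hW, hW2⟩ := P.rank_exists
      exact ⟨W, (hti W).mp hW, hW2⟩) p₀.rep_nonzero (hOB p₀ hp₀')
  set A := (O.toFinset.erase p₀).filter fun y => P.B y.rep p₀.rep = 0
  set D := (O.toFinset.erase p₀).filter fun y => ¬ P.B y.rep p₀.rep = 0
  have hlineO := hm W hW hW2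
  have hp₀W : p₀ ∈ O.toFinset.filter fun p => p.rep ∈ W := Finset.mem_filter.mpr ⟨hp₀', hpW⟩
  have hline := Finset.card_erase_add_one hp₀W
  have hA : A.card + (q ^ 3 + 1) = (q ^ 3 + 1) * m := by
    have h := hB.card_collinear_off_line hq hOB hm hW hW2 hpW
    have hAeq : A = (O.toFinset.filter fun p => p.rep ∈ W).erase p₀ ∪
        O.toFinset.filter fun y => P.B y.rep p₀.rep = 0 ∧ y.rep ∉ W := by
      ext y
      simp only [A, Finset.mem_filter, Finset.mem_erase, Finset.mem_union]
      constructor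
      · rintro ⟨⟨hne, hy⟩, hyp⟩
        by_cases hyW : y.rep ∈ W
        · exact Or.inl ⟨hne, hy, hyW⟩
        · exact Or.inr ⟨hy, hyp, hyW⟩
      · rintro (⟨hne, hy, hyW⟩ | ⟨hy, hyp, hyW⟩)
        · exact ⟨⟨hne, hy⟩, hW _ hyW _ hpW⟩
        · exact ⟨⟨fun h => hyW (h ▸ hpW), hy⟩, hyp⟩
    have hdisj : Disjoint ((O.toFinset.filter fun p => p.rep ∈ W).erase p₀)
        (O.toFinset.filter fun y => P.B y.rep p₀.rep = 0 ∧ y.rep ∉ W) := by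
      refine Finset.disjoint_left.mpr fun y hy hy' => ?_
      exact (Finset.mem_filter.mp hy').2.2 (Finset.mem_filter.mp (Finset.mem_of_mem_erase hy)).2
    rw [hAeq, Finset.card_union_of_disjoint hdisj, h]
    rw [hlineO] at hline
    rw [← hline]
    ring
  have hAD : A.card + D.card + 1 = O.toFinset.card := by
    rw [Finset.card_filter_add_card_filter_not, Finset.card_erase_add_one hp₀']
  have hcardO : m + m * q ^ 5 ≤ O.toFinset.card := by
    rw [← Finset.card_filter_add_card_filter_not (s := O.toFinset) (fun y => y.rep ∈ W), hlineO]
    exact Nat.add_le_add_left (hB.card_off_line_ge hq hOB hm hW hW2) m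
  have hAval : ∀ p ∈ A, nwt O {p} *
      nwt O (pts (Submodule.span F {p₀.rep} ⊔ Submodule.span F {p.rep})) = m := by
    intro p hp
    obtain ⟨hp, hpp⟩ := Finset.mem_filter.mp hp
    obtain ⟨hne, hp⟩ := Finset.mem_erase.mp hp
    rw [nwt_singleton (Set.mem_toFinset.mp hp), one_mul, nwt, hgen]
    refine ⟨(hti _).mpr (hB.totallyIsotropic_sup (hOB _ hp₀') (hOB _ hp) (hB.symm_zero hpp)),
      finrank_span_sup_span p₀.rep_nonzero fun h => hne (eq_of_rep_mem_span h)⟩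
  have hDval : ∀ p ∈ D, 2 ≤ nwt O {p} *
      nwt O (pts (Submodule.span F {p₀.rep} ⊔ Submodule.span F {p.rep})) := by
    intro p hp
    obtain ⟨hne, hp⟩ := Finset.mem_erase.mp (Finset.mem_filter.mp hp).1
    have hp := Set.mem_toFinset.mp hp
    rw [nwt_singleton hp, one_mul, nwt]
    have hsub : {p₀, p} ⊆ pts (Submodule.span F {p₀.rep} ⊔ Submodule.span F {p.rep}) ∩ O := by
      rintro x (rfl | rfl)
      · exact ⟨Submodule.mem_sup_left (Submodule.mem_span_singleton_self _), hp₀⟩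
      · exact ⟨Submodule.mem_sup_right (Submodule.mem_span_singleton_self _), hp⟩
    have h := Set.ncard_le_ncard hsub (Set.toFinite _)
    rw [Set.ncard_pair hne.symm] at h
    exact_mod_cast h
  have hsum : (m : ℝ) * A.card + 2 * D.card ≤ ∑ᶠ p ∈ P.sing \ {p₀}, nwt O {p} *
      nwt O (pts (Submodule.span F {p₀.rep} ⊔ Submodule.span F {p.rep})) := by
    rw [finsum_mem_eq_toFinset_sum]
    refine le_trans ?_ (Finset.sum_le_sum_of_subset_of_nonneg (s := O.toFinset.erase p₀) ?_
      fun p _ _ => mul_nonneg (nwt_nonneg _ _) (nwt_nonneg _ _))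
    · rw [← Finset.sum_filter_add_sum_filter_not _ fun y => P.B y.rep p₀.rep = 0,
        Finset.sum_congr rfl hAval]
      refine add_le_add ?_ ?_
      · rw [Finset.sum_const, nsmul_eq_mul, mul_comm]
      · refine le_trans ?_ (Finset.sum_le_sum hDval)
        rw [Finset.sum_const, nsmul_eq_mul, mul_comm]
    · intro p hp
      obtain ⟨hne, hp⟩ := Finset.mem_erase.mp hp
      simpa using ⟨hOs (Set.mem_toFinset.mp hp), hne⟩
  refine ge_trans hsum ?_
  have hA' : (A.card : ℝ) = (q ^ 3 + 1) * m - (q ^ 3 + 1) := by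
    rw [eq_sub_iff_add_eq]
    exact_mod_cast hA
  have hD' : (m : ℝ) + m * q ^ 5 ≤ A.card + D.card + 1 := by
    exact_mod_cast hcardO.trans_eq hAD.symm
  rw [hA'] at hD' ⊢
  linarith

end PolarOvoids
end
end
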